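/- Let {Γ_t}, t ∈ [0,∞), be a curve shortening flow of simple closed curves on the unit sphere S² ⊂ ℝ³ defined for all positive times, with geodesic curvature κ and total length L(t), and suppose that at t = 0 there exists a > 0 such that d(x,y)/L(0) ≥ a⁻¹ arctan((a/π) sin(π ℓ(x,y,0)/L(0))) for all x, y ∈ Γ₀. Then L(t) → 2π as t → ∞, and there exist constants C > 0 and δ > 0 such that max_{Γ_t} κ² ≤ C e^{−δ t} for all t ≥ 0. -/

import Mathlib

open Real MeasureTheory

noncomputable section

/-- Arclength derivative `∂_s f = |∂_u γ|⁻¹ ∂_u f` along the family of curves `u ↦ γ u t`. -/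
def pS (γ f : ℝ → ℝ → EuclideanSpace ℝ (Fin 3)) (u t : ℝ) : EuclideanSpace ℝ (Fin 3) :=
  ‖deriv (fun v => γ v t) u‖⁻¹ • deriv (fun v => f v t) u

/-- The geodesic curvature vector `∂_s²γ + γ` of the spherical curve `u ↦ γ u t`. -/
def curvVec (γ : ℝ → ℝ → EuclideanSpace ℝ (Fin 3)) (u t : ℝ) : EuclideanSpace ℝ (Fin 3) :=
  pS γ (pS γ γ) u t + γ u t

/-- A curve shortening flow `∂_t γ = ∂_s²γ + γ` of simple closed curves on the unit sphere
`S² ⊂ ℝ³`, defined for times `t` in the set `D` (each `γ(·,t)` is a `2π`-periodic regular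
parametrisation, injective on a period, of a simple closed spherical curve `Γ_t`). -/
structure SphereCSF (D : Set ℝ) where
  γ : ℝ → ℝ → EuclideanSpace ℝ (Fin 3)
  smooth : ContDiffOn ℝ (⊤ : ℕ∞) (fun p : ℝ × ℝ => γ p.1 p.2) (Set.univ ×ˢ D)
  spherical : ∀ t ∈ D, ∀ u, ‖γ u t‖ = 1
  periodic : ∀ t ∈ D, Function.Periodic (fun u => γ u t) (2 * π)
  regular : ∀ t ∈ D, ∀ u, deriv (fun v => γ v t) u ≠ 0
  simple : ∀ t ∈ D, Set.InjOn (fun u => γ u t) (Set.Ico 0 (2 * π))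
  flow : ∀ t ∈ D, ∀ u, HasDerivWithinAt (fun s => γ u s) (curvVec γ u t) D t

variable {D : Set ℝ}

/-- The parametrisation speed `|∂_u γ|`. -/
def SphereCSF.speed (F : SphereCSF D) (u t : ℝ) : ℝ := ‖deriv (fun v => F.γ v t) u‖

/-- The total length `L(t)` of the curve `Γ_t`. -/
def SphereCSF.length (F : SphereCSF D) (t : ℝ) : ℝ := ∫ u in (0:ℝ)..(2 * π), F.speed u t

/-- The length `ℓ` of the shorter of the two arcs of `Γ_t` joining `γ(u,t)` to `γ(v,t)`. -/
def SphereCSF.arcLen (F : SphereCSF D) (t u v : ℝ) : ℝ :=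
  min |∫ w in u..v, F.speed w t| (F.length t - |∫ w in u..v, F.speed w t|)

/-- The Euclidean chord length `d` between `γ(u,t)` and `γ(v,t)`. -/
def SphereCSF.chord (F : SphereCSF D) (t u v : ℝ) : ℝ := ‖F.γ u t - F.γ v t‖

/-- The squared geodesic curvature `κ² = |∂_s²γ + γ|²`. -/
def SphereCSF.curvSq (F : SphereCSF D) (u t : ℝ) : ℝ := ‖curvVec F.γ u t‖ ^ 2

/-- The rescaled time `τ(t) = ∫₀ᵗ L(s)⁻² ds`. -/
def SphereCSF.tau (F : SphereCSF D) (t : ℝ) : ℝ := ∫ s in (0:ℝ)..t, ((F.length s) ^ 2)⁻¹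

open scoped ContDiff

/-- The derivative of `f` in the constant direction `e`. -/
def dirDeriv {V : Type*} [NormedAddCommGroup V] [NormedSpace ℝ V] (e : ℝ × ℝ) (f : ℝ × ℝ → V)
    (p : ℝ × ℝ) : V := fderiv ℝ f p e

section DirDeriv

variable {V : Type*} [NormedAddCommGroup V] [NormedSpace ℝ V]

lemma contDiff_dirDeriv {f : ℝ × ℝ → V} (hf : ContDiff ℝ ∞ f) (e : ℝ × ℝ) :
    ContDiff ℝ ∞ (dirDeriv e f) :=
  (hf.fderiv_right (m := ∞) (by simp)).clm_apply contDiff_const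

lemma smooth_differentiable {f : ℝ × ℝ → V} (hf : ContDiff ℝ ∞ f) : Differentiable ℝ f :=
  hf.differentiable (by simp)

lemma dirDeriv_add {f g : ℝ × ℝ → V} (hf : ContDiff ℝ ∞ f) (hg : ContDiff ℝ ∞ g) (e p : ℝ × ℝ) :
    dirDeriv e (fun q => f q + g q) p = dirDeriv e f p + dirDeriv e g p := by
  simp [dirDeriv, fderiv_fun_add (smooth_differentiable hf p) (smooth_differentiable hg p)]

lemma dirDeriv_smul {c : ℝ × ℝ → ℝ} {f : ℝ × ℝ → V} (hc : ContDiff ℝ ∞ c) (hf : ContDiff ℝ ∞ f)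
    (e p : ℝ × ℝ) :
    dirDeriv e (fun q => c q • f q) p = c p • dirDeriv e f p + dirDeriv e c p • f p := by
  simp [dirDeriv, fderiv_fun_smul (smooth_differentiable hc p) (smooth_differentiable hf p)]

lemma dirDeriv_mul {c f : ℝ × ℝ → ℝ} (hc : ContDiff ℝ ∞ c) (hf : ContDiff ℝ ∞ f)
    (e p : ℝ × ℝ) :
    dirDeriv e (fun q => c q * f q) p = c p * dirDeriv e f p + dirDeriv e c p * f p := by
  simpa using dirDeriv_smul hc hf e p

lemma dirDeriv_pow {c : ℝ × ℝ → ℝ} (hc : ContDiff ℝ ∞ c) (n : ℕ) (e p : ℝ × ℝ) :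
    dirDeriv e (fun q => c q ^ n) p = n * c p ^ (n - 1) * dirDeriv e c p := by
  simp [dirDeriv, fderiv_fun_pow n (smooth_differentiable hc p), mul_assoc]

lemma dirDeriv_inner {W : Type*} [NormedAddCommGroup W] [InnerProductSpace ℝ W]
    {f g : ℝ × ℝ → W} (hf : ContDiff ℝ ∞ f) (hg : ContDiff ℝ ∞ g) (e p : ℝ × ℝ) :
    dirDeriv e (fun q => inner ℝ (f q) (g q)) p
      = inner ℝ (f p) (dirDeriv e g p) + inner ℝ (dirDeriv e f p) (g p) := by
  rw [dirDeriv, fderiv_inner_apply ℝ (smooth_differentiable hf p) (smooth_differentiable hg p)]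
  rfl

lemma dirDeriv_const (c : V) (e p : ℝ × ℝ) : dirDeriv e (fun _ => c) p = 0 := by
  simp [dirDeriv]

lemma dirDeriv_comm {f : ℝ × ℝ → V} (hf : ContDiff ℝ ∞ f) (e e' p : ℝ × ℝ) :
    dirDeriv e (dirDeriv e' f) p = dirDeriv e' (dirDeriv e f) p := by
  have hd : DifferentiableAt ℝ (fderiv ℝ f) p :=
    ((hf.fderiv_right (m := ∞) (by simp)).differentiable (by simp)) p
  have key : ∀ a b : ℝ × ℝ, dirDeriv a (dirDeriv b f) p = fderiv ℝ (fderiv ℝ f) p a b := by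
    intro a b
    have : dirDeriv b f = fun q => (fderiv ℝ f q) b := rfl
    rw [this, dirDeriv, fderiv_clm_apply hd (differentiableAt_const b)]
    simp
  rw [key, key]
  have := (hf.contDiffAt (x := p)).isSymmSndFDerivAt
    (by rw [minSmoothness_of_isRCLikeNormedField]; exact WithTop.coe_le_coe.2 (le_top : (2 : ℕ∞) ≤ ⊤))
  exact this e e'

lemma hasDerivAt_fst {f : ℝ × ℝ → V} (hf : ContDiff ℝ ∞ f) (u τ : ℝ) :
    HasDerivAt (fun w => f (w, τ)) (dirDeriv (1, 0) f (u, τ)) u :=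
  HasFDerivAt.comp_hasDerivAt u (smooth_differentiable hf (u, τ)).hasFDerivAt
    ((hasDerivAt_id u).prodMk (hasDerivAt_const u τ))

lemma hasDerivAt_snd {f : ℝ × ℝ → V} (hf : ContDiff ℝ ∞ f) (u τ : ℝ) :
    HasDerivAt (fun σ => f (u, σ)) (dirDeriv (0, 1) f (u, τ)) τ :=
  HasFDerivAt.comp_hasDerivAt τ (smooth_differentiable hf (u, τ)).hasFDerivAt
    ((hasDerivAt_const τ u).prodMk (hasDerivAt_id τ))

lemma hasDerivAt_integral_fst {f : ℝ × ℝ → ℝ} (hf : ContDiff ℝ ∞ f) (a b τ : ℝ) :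
    HasDerivAt (fun σ => ∫ u in a..b, f (u, σ)) (∫ u in a..b, dirDeriv (0, 1) f (u, τ)) τ := by
  have hc := hf.continuous
  have hdc := (contDiff_dirDeriv hf (0, 1)).continuous
  have hK : IsCompact (Set.uIcc a b ×ˢ Set.Icc (τ - 1) (τ + 1)) :=
    isCompact_uIcc.prod isCompact_Icc
  obtain ⟨C, hC⟩ := hK.exists_bound_of_continuousOn hdc.continuousOn
  refine (intervalIntegral.hasDerivAt_integral_of_dominated_loc_of_deriv_le
    (F := fun σ u => f (u, σ)) (F' := fun σ u => dirDeriv (0, 1) f (u, σ))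
    (s := Set.Icc (τ - 1) (τ + 1)) (bound := fun _ => C)
    (Icc_mem_nhds (by linarith) (by linarith)) ?_ ?_ ?_ ?_ ?_ ?_).2
  · exact Filter.Eventually.of_forall fun σ =>
      (by fun_prop : Continuous fun u => f (u, σ)).aestronglyMeasurable
  · exact (by fun_prop : Continuous fun u => f (u, τ)).intervalIntegrable _ _
  · exact (by fun_prop : Continuous fun u => dirDeriv (0, 1) f (u, τ)).aestronglyMeasurable
  · exact Filter.Eventually.of_forall fun u hu σ hσ =>
      hC (u, σ) ⟨Set.uIoc_subset_uIcc hu, hσ⟩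
  · exact intervalIntegrable_const
  · exact Filter.Eventually.of_forall fun u _ σ _ => hasDerivAt_snd hf u σ

lemma integral_dirDeriv_fst_of_periodic {f : ℝ × ℝ → ℝ} (hf : ContDiff ℝ ∞ f)
    (hper : ∀ u τ, f (u + 2 * π, τ) = f (u, τ)) (τ : ℝ) :
    ∫ u in (0 : ℝ)..(2 * π), dirDeriv (1, 0) f (u, τ) = 0 := by
  have hdc := (contDiff_dirDeriv hf (1, 0)).continuous
  rw [intervalIntegral.integral_eq_sub_of_hasDerivAt (fun u _ => hasDerivAt_fst hf u τ)
    ((by fun_prop : Continuous fun u => dirDeriv (1, 0) f (u, τ)).intervalIntegrable _ _)]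
  have := hper 0 τ
  rw [zero_add] at this
  rw [this, sub_self]

lemma dirDeriv_fst_periodic {f : ℝ × ℝ → V} (hf : ContDiff ℝ ∞ f)
    (hper : ∀ u τ, f (u + 2 * π, τ) = f (u, τ)) (u τ : ℝ) :
    dirDeriv (1, 0) f (u + 2 * π, τ) = dirDeriv (1, 0) f (u, τ) := by
  have h1 := (hasDerivAt_fst hf (u + 2 * π) τ).comp_add_const u (2 * π)
  have h2 := hasDerivAt_fst hf u τ
  simp only [hper] at h1
  exact h1.unique h2

end DirDeriv

/-- The cross product on `ℝ³`. -/
def cross3 (a b : EuclideanSpace ℝ (Fin 3)) : EuclideanSpace ℝ (Fin 3) :=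
  !₂[a 1 * b 2 - a 2 * b 1, a 2 * b 0 - a 0 * b 2, a 0 * b 1 - a 1 * b 0]

lemma contDiff_cross3 {f g : ℝ × ℝ → EuclideanSpace ℝ (Fin 3)} (hf : ContDiff ℝ ∞ f)
    (hg : ContDiff ℝ ∞ g) : ContDiff ℝ ∞ (fun p => cross3 (f p) (g p)) := by
  rw [contDiff_euclidean] at hf hg ⊢
  have f0 := hf 0
  have f1 := hf 1
  have f2 := hf 2
  have g0 := hg 0
  have g1 := hg 1
  have g2 := hg 2
  intro i
  fin_cases i <;> simp only [cross3] <;> simp <;> fun_prop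

lemma inner_cross3_left (a b : EuclideanSpace ℝ (Fin 3)) : inner ℝ a (cross3 a b) = 0 := by
  simp [cross3, PiLp.inner_apply, Fin.sum_univ_three]
  ring

lemma inner_cross3_right (a b : EuclideanSpace ℝ (Fin 3)) : inner ℝ b (cross3 a b) = 0 := by
  simp [cross3, PiLp.inner_apply, Fin.sum_univ_three]
  ring

/-- Lagrange's identity, polarised. -/
lemma inner_cross3_cross3 (a b c d : EuclideanSpace ℝ (Fin 3)) :
    inner ℝ (cross3 a b) (cross3 c d)
      = inner ℝ a c * inner ℝ b d - inner ℝ a d * inner ℝ b c := by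
  simp [cross3, PiLp.inner_apply, Fin.sum_univ_three]
  ring

lemma orthonormal_cross3 {a b : EuclideanSpace ℝ (Fin 3)} (ha : inner ℝ a a = (1 : ℝ))
    (hb : inner ℝ b b = (1 : ℝ)) (hab : inner ℝ a b = (0 : ℝ)) :
    Orthonormal ℝ ![a, b, cross3 a b] := by
  have hc : inner ℝ (cross3 a b) (cross3 a b) = (1 : ℝ) := by
    rw [inner_cross3_cross3, ha, hb, hab, real_inner_comm, hab]; norm_num
  have h1 := inner_cross3_left a b
  have h2 := inner_cross3_right a b
  have hba : inner ℝ b a = (0 : ℝ) := by rw [real_inner_comm, hab]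
  have h3 : inner ℝ (cross3 a b) a = (0 : ℝ) := by rw [real_inner_comm, h1]
  have h4 : inner ℝ (cross3 a b) b = (0 : ℝ) := by rw [real_inner_comm, h2]
  rw [orthonormal_iff_ite]
  intro i j
  fin_cases i <;> fin_cases j <;> simp_all

lemma eq_sum_cross3 {a b : EuclideanSpace ℝ (Fin 3)} (ha : inner ℝ a a = (1 : ℝ))
    (hb : inner ℝ b b = (1 : ℝ)) (hab : inner ℝ a b = (0 : ℝ)) (x : EuclideanSpace ℝ (Fin 3)) :
    x = (inner ℝ x a : ℝ) • a + (inner ℝ x b : ℝ) • b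
      + (inner ℝ x (cross3 a b) : ℝ) • cross3 a b := by
  have ho := orthonormal_cross3 ha hb hab
  have hcard : Fintype.card (Fin 3) = Module.finrank ℝ (EuclideanSpace ℝ (Fin 3)) := by simp
  have hspan : ⊤ ≤ Submodule.span ℝ (Set.range ![a, b, cross3 a b]) := by
    rw [← (basisOfOrthonormalOfCardEqFinrank ho hcard).span_eq,
      coe_basisOfOrthonormalOfCardEqFinrank]
  have := (OrthonormalBasis.mk ho hspan).sum_repr' x
  simp only [OrthonormalBasis.coe_mk, Fin.sum_univ_three] at this
  conv_lhs => rw [← this]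
  simp [real_inner_comm]

section Flow

/-- The parametrisation speed of `u ↦ g (u, τ)`. -/
def gSpeed (g : ℝ × ℝ → EuclideanSpace ℝ (Fin 3)) (p : ℝ × ℝ) : ℝ := ‖dirDeriv (1, 0) g p‖

/-- The arclength derivative along `u ↦ g (u, τ)`. -/
def gArc {V : Type*} [NormedAddCommGroup V] [NormedSpace ℝ V]
    (g : ℝ × ℝ → EuclideanSpace ℝ (Fin 3)) (f : ℝ × ℝ → V) (p : ℝ × ℝ) : V :=
  (gSpeed g p)⁻¹ • dirDeriv (1, 0) f p

/-- The unit tangent vector. -/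
def gTangent (g : ℝ × ℝ → EuclideanSpace ℝ (Fin 3)) : ℝ × ℝ → EuclideanSpace ℝ (Fin 3) := gArc g g

/-- The unit normal vector in the sphere. -/
def gNormal (g : ℝ × ℝ → EuclideanSpace ℝ (Fin 3)) (p : ℝ × ℝ) : EuclideanSpace ℝ (Fin 3) :=
  cross3 (g p) (gTangent g p)

/-- The signed geodesic curvature. -/
def gCurv (g : ℝ × ℝ → EuclideanSpace ℝ (Fin 3)) (p : ℝ × ℝ) : ℝ :=
  inner ℝ (gArc g (gTangent g) p) (gNormal g p)

/-- Curve shortening flow of closed spherical curves in logarithmic time `τ = log t`. -/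
structure IsLogFlow (g : ℝ × ℝ → EuclideanSpace ℝ (Fin 3)) : Prop where
  smooth : ContDiff ℝ ∞ g
  unit : ∀ p, ‖g p‖ = 1
  regular : ∀ p, dirDeriv (1, 0) g p ≠ 0
  periodic : ∀ u τ, g (u + 2 * π, τ) = g (u, τ)
  flow : ∀ p, dirDeriv (0, 1) g p = Real.exp p.2 • (gArc g (gTangent g) p + g p)

variable {g : ℝ × ℝ → EuclideanSpace ℝ (Fin 3)}

namespace IsLogFlow

lemma speed_pos (h : IsLogFlow g) (p : ℝ × ℝ) : 0 < gSpeed g p := norm_pos_iff.2 (h.regular p)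

lemma speed_smooth (h : IsLogFlow g) : ContDiff ℝ ∞ (gSpeed g) :=
  (contDiff_dirDeriv h.smooth _).norm ℝ h.regular

lemma arc_smooth {V : Type*} [NormedAddCommGroup V] [NormedSpace ℝ V] (h : IsLogFlow g)
    {f : ℝ × ℝ → V} (hf : ContDiff ℝ ∞ f) : ContDiff ℝ ∞ (gArc g f) :=
  (h.speed_smooth.inv fun p => (h.speed_pos p).ne').smul (contDiff_dirDeriv hf _)

lemma tangent_smooth (h : IsLogFlow g) : ContDiff ℝ ∞ (gTangent g) := h.arc_smooth h.smooth

lemma normal_smooth (h : IsLogFlow g) : ContDiff ℝ ∞ (gNormal g) :=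
  contDiff_cross3 h.smooth h.tangent_smooth

lemma curv_smooth (h : IsLogFlow g) : ContDiff ℝ ∞ (gCurv g) :=
  (h.arc_smooth h.tangent_smooth).inner ℝ h.normal_smooth

lemma dirDeriv_fst_eq {V : Type*} [NormedAddCommGroup V] [NormedSpace ℝ V] (h : IsLogFlow g)
    (f : ℝ × ℝ → V) (p : ℝ × ℝ) : dirDeriv (1, 0) f p = gSpeed g p • gArc g f p := by
  rw [gArc, smul_smul, mul_inv_cancel₀ (h.speed_pos p).ne', one_smul]

lemma speed_periodic (h : IsLogFlow g) (u τ : ℝ) : gSpeed g (u + 2 * π, τ) = gSpeed g (u, τ) := by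
  simp only [gSpeed, dirDeriv_fst_periodic h.smooth h.periodic]

lemma arc_periodic {V : Type*} [NormedAddCommGroup V] [NormedSpace ℝ V] (h : IsLogFlow g)
    {f : ℝ × ℝ → V} (hf : ContDiff ℝ ∞ f) (hper : ∀ u τ, f (u + 2 * π, τ) = f (u, τ)) (u τ : ℝ) :
    gArc g f (u + 2 * π, τ) = gArc g f (u, τ) := by
  simp only [gArc, h.speed_periodic, dirDeriv_fst_periodic hf hper]

lemma tangent_periodic (h : IsLogFlow g) (u τ : ℝ) :
    gTangent g (u + 2 * π, τ) = gTangent g (u, τ) :=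
  h.arc_periodic h.smooth h.periodic u τ

lemma curv_periodic (h : IsLogFlow g) (u τ : ℝ) : gCurv g (u + 2 * π, τ) = gCurv g (u, τ) := by
  simp only [gCurv, gNormal, h.periodic, h.tangent_periodic,
    h.arc_periodic h.tangent_smooth h.tangent_periodic]

lemma arc_inner {W : Type*} [NormedAddCommGroup W] [InnerProductSpace ℝ W]
    {a b : ℝ × ℝ → W} (ha : ContDiff ℝ ∞ a) (hb : ContDiff ℝ ∞ b) (p : ℝ × ℝ) :
    gArc g (fun q => inner ℝ (a q) (b q)) p
      = inner ℝ (a p) (gArc g b p) + inner ℝ (gArc g a p) (b p) := by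
  simp only [gArc, dirDeriv_inner ha hb, inner_smul_left, inner_smul_right, smul_eq_mul, mul_add]
  simp

lemma arc_smul {V : Type*} [NormedAddCommGroup V] [NormedSpace ℝ V]
    {c : ℝ × ℝ → ℝ} {f : ℝ × ℝ → V} (hc : ContDiff ℝ ∞ c) (hf : ContDiff ℝ ∞ f) (p : ℝ × ℝ) :
    gArc g (fun q => c q • f q) p = c p • gArc g f p + gArc g c p • f p := by
  simp only [gArc, dirDeriv_smul hc hf, smul_eq_mul]
  module

lemma arc_add {V : Type*} [NormedAddCommGroup V] [NormedSpace ℝ V]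
    {a b : ℝ × ℝ → V} (ha : ContDiff ℝ ∞ a) (hb : ContDiff ℝ ∞ b) (p : ℝ × ℝ) :
    gArc g (fun q => a q + b q) p = gArc g a p + gArc g b p := by
  simp only [gArc, dirDeriv_add ha hb, smul_add]

lemma arc_const {V : Type*} [NormedAddCommGroup V] [NormedSpace ℝ V] (c : V) (p : ℝ × ℝ) :
    gArc g (fun _ => c) p = 0 := by
  simp [gArc, dirDeriv_const]

lemma inner_self (h : IsLogFlow g) (p : ℝ × ℝ) : inner ℝ (g p) (g p) = (1 : ℝ) := by
  rw [real_inner_self_eq_norm_sq, h.unit]; norm_num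

lemma inner_tangent (h : IsLogFlow g) (p : ℝ × ℝ) : inner ℝ (g p) (gTangent g p) = (0 : ℝ) := by
  have h1 := arc_inner (g := g) h.smooth h.smooth p
  simp only [h.inner_self, arc_const] at h1
  rw [real_inner_comm (g p)] at h1
  have : inner ℝ (g p) (gArc g g p) = (0 : ℝ) := by linarith
  exact this

lemma tangent_tangent (h : IsLogFlow g) (p : ℝ × ℝ) :
    inner ℝ (gTangent g p) (gTangent g p) = (1 : ℝ) := by
  have := (h.speed_pos p).ne'
  rw [real_inner_self_eq_norm_sq, gTangent, gArc, norm_smul, norm_inv,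
    Real.norm_of_nonneg (h.speed_pos p).le, ← gSpeed, inv_mul_cancel₀ this]
  norm_num

lemma inner_normal (p : ℝ × ℝ) : inner ℝ (g p) (gNormal g p) = (0 : ℝ) :=
  inner_cross3_left _ _

lemma tangent_normal (p : ℝ × ℝ) : inner ℝ (gTangent g p) (gNormal g p) = (0 : ℝ) :=
  inner_cross3_right _ _

lemma normal_normal (h : IsLogFlow g) (p : ℝ × ℝ) :
    inner ℝ (gNormal g p) (gNormal g p) = (1 : ℝ) := by
  rw [gNormal, inner_cross3_cross3, h.inner_self, h.tangent_tangent, h.inner_tangent,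
    real_inner_comm, h.inner_tangent]
  norm_num

lemma expand (h : IsLogFlow g) (p : ℝ × ℝ) (x : EuclideanSpace ℝ (Fin 3)) :
    x = (inner ℝ x (g p) : ℝ) • g p + (inner ℝ x (gTangent g p) : ℝ) • gTangent g p
      + (inner ℝ x (gNormal g p) : ℝ) • gNormal g p :=
  eq_sum_cross3 (h.inner_self p) (h.tangent_tangent p) (h.inner_tangent p) x

/-- Differentiating a constant inner product. -/
lemma dirDeriv_inner_const {a b : ℝ × ℝ → EuclideanSpace ℝ (Fin 3)} (ha : ContDiff ℝ ∞ a)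
    (hb : ContDiff ℝ ∞ b) {c : ℝ} (hab : ∀ p, inner ℝ (a p) (b p) = c) (e p : ℝ × ℝ) :
    inner ℝ (dirDeriv e a p) (b p) = -(inner ℝ (a p) (dirDeriv e b p) : ℝ) := by
  have h1 := dirDeriv_inner ha hb e p
  simp only [hab, dirDeriv_const] at h1
  linarith

lemma arc_inner_const {a b : ℝ × ℝ → EuclideanSpace ℝ (Fin 3)} (ha : ContDiff ℝ ∞ a)
    (hb : ContDiff ℝ ∞ b) {c : ℝ} (hab : ∀ p, inner ℝ (a p) (b p) = c) (p : ℝ × ℝ) :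
    inner ℝ (gArc g a p) (b p) = -(inner ℝ (a p) (gArc g b p) : ℝ) := by
  have h1 := arc_inner (g := g) ha hb p
  simp only [hab, arc_const] at h1
  linarith

lemma arc_tangent (h : IsLogFlow g) (p : ℝ × ℝ) :
    gArc g (gTangent g) p = -g p + gCurv g p • gNormal g p := by
  have h1 : inner ℝ (gArc g (gTangent g) p) (g p) = (-1 : ℝ) := by
    rw [arc_inner_const h.tangent_smooth h.smooth
      (fun q => by rw [real_inner_comm, h.inner_tangent])]
    exact congrArg _ (h.tangent_tangent p)
  have h2 : inner ℝ (gArc g (gTangent g) p) (gTangent g p) = (0 : ℝ) := by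
    have := arc_inner_const (g := g) h.tangent_smooth h.tangent_smooth h.tangent_tangent p
    rw [real_inner_comm (gArc g (gTangent g) p)] at this
    linarith
  conv_lhs => rw [h.expand p (gArc g (gTangent g) p)]
  rw [h1, h2, ← gCurv]
  module

lemma arc_normal (h : IsLogFlow g) (p : ℝ × ℝ) :
    gArc g (gNormal g) p = -(gCurv g p • gTangent g p) := by
  have h1 : inner ℝ (gArc g (gNormal g) p) (g p) = (0 : ℝ) := by
    rw [arc_inner_const h.normal_smooth h.smooth
      (fun q => by rw [real_inner_comm, inner_normal])]
    rw [real_inner_comm]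
    exact neg_eq_zero.2 (tangent_normal p)
  have h2 : inner ℝ (gArc g (gNormal g) p) (gTangent g p) = -gCurv g p := by
    rw [arc_inner_const h.normal_smooth h.tangent_smooth
      (fun q => by rw [real_inner_comm, tangent_normal]), real_inner_comm, gCurv]
  have h3 : inner ℝ (gArc g (gNormal g) p) (gNormal g p) = (0 : ℝ) := by
    have := arc_inner_const (g := g) h.normal_smooth h.normal_smooth h.normal_normal p
    rw [real_inner_comm (gArc g (gNormal g) p)] at this
    linarith
  conv_lhs => rw [h.expand p (gArc g (gNormal g) p)]
  rw [h1, h2, h3]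
  module

lemma flow_normal (h : IsLogFlow g) (p : ℝ × ℝ) :
    dirDeriv (0, 1) g p = (Real.exp p.2 * gCurv g p) • gNormal g p := by
  rw [h.flow, h.arc_tangent]
  module

lemma exp_snd_smooth : ContDiff ℝ ∞ (fun p : ℝ × ℝ => Real.exp p.2) := by fun_prop

lemma arc_exp_snd (p : ℝ × ℝ) : gArc g (fun p : ℝ × ℝ => Real.exp p.2) p = 0 := by
  have h1 := hasDerivAt_fst exp_snd_smooth p.1 p.2
  have h2 := (hasDerivAt_const p.1 (Real.exp p.2)).unique h1
  rw [gArc]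
  simp only [Prod.mk.eta] at h2
  rw [← h2, smul_zero]

/-- The arclength derivative of the velocity. -/
lemma arc_velocity (h : IsLogFlow g) (p : ℝ × ℝ) :
    gArc g (dirDeriv (0, 1) g) p = (Real.exp p.2 * gArc g (gCurv g) p) • gNormal g p
      - (Real.exp p.2 * gCurv g p ^ 2) • gTangent g p := by
  have hk := h.curv_smooth
  have e1 : dirDeriv (0, 1) g = fun p => (Real.exp p.2 • gCurv g p) • gNormal g p :=
    funext h.flow_normal
  have hs : ContDiff ℝ ∞ fun p : ℝ × ℝ => Real.exp p.2 • gCurv g p := exp_snd_smooth.smul hk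
  rw [e1, arc_smul hs h.normal_smooth, arc_smul exp_snd_smooth hk, arc_exp_snd, h.arc_normal]
  simp only [smul_eq_mul]
  module

lemma dirDeriv_snd_speed (h : IsLogFlow g) (p : ℝ × ℝ) :
    dirDeriv (0, 1) (gSpeed g) p = -(Real.exp p.2 * gCurv g p ^ 2 * gSpeed g p) := by
  have hu := contDiff_dirDeriv h.smooth (1, 0)
  have e1 : (fun p => gSpeed g p ^ 2)
      = fun p => inner ℝ (dirDeriv (1, 0) g p) (dirDeriv (1, 0) g p) := by
    funext q; rw [real_inner_self_eq_norm_sq, gSpeed]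
  have h1 := dirDeriv_pow h.speed_smooth 2 (0, 1) p
  rw [e1, dirDeriv_inner hu hu, real_inner_comm, dirDeriv_comm h.smooth (0, 1) (1, 0),
    h.dirDeriv_fst_eq (dirDeriv (0, 1) g), h.dirDeriv_fst_eq g, h.arc_velocity] at h1
  have e2 : gArc g g p = gTangent g p := rfl
  have e3 : inner ℝ (gNormal g p) (gTangent g p) = (0 : ℝ) := by
    rw [real_inner_comm, tangent_normal]
  simp only [e2, inner_smul_left, inner_smul_right, inner_sub_left, e3,
    h.tangent_tangent] at h1
  simp at h1
  have hv := (h.speed_pos p).ne'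
  apply mul_left_cancel₀ hv
  linarith

/-- The commutator of the time derivative and the arclength derivative. -/
lemma dirDeriv_snd_arc {V : Type*} [NormedAddCommGroup V] [NormedSpace ℝ V] (h : IsLogFlow g)
    {f : ℝ × ℝ → V} (hf : ContDiff ℝ ∞ f) (p : ℝ × ℝ) :
    dirDeriv (0, 1) (gArc g f) p
      = gArc g (dirDeriv (0, 1) f) p + (Real.exp p.2 * gCurv g p ^ 2) • gArc g f p := by
  have hv := (h.speed_pos p).ne'
  have e1 : dirDeriv (1, 0) f = fun q => gSpeed g q • gArc g f q := funext (h.dirDeriv_fst_eq f)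
  have h1 := dirDeriv_comm hf (0, 1) (1, 0) p
  rw [h.dirDeriv_fst_eq (dirDeriv (0, 1) f)] at h1
  rw [e1, dirDeriv_smul h.speed_smooth (h.arc_smooth hf), h.dirDeriv_snd_speed] at h1
  apply smul_right_injective V hv
  simp only
  rw [smul_add, ← h1]
  module

lemma dirDeriv_snd_tangent (h : IsLogFlow g) (p : ℝ × ℝ) :
    dirDeriv (0, 1) (gTangent g) p = (Real.exp p.2 * gArc g (gCurv g) p) • gNormal g p := by
  rw [gTangent, h.dirDeriv_snd_arc h.smooth, h.arc_velocity, gTangent]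
  module

/-- The evolution of the geodesic curvature. -/
lemma dirDeriv_snd_curv (h : IsLogFlow g) (p : ℝ × ℝ) :
    dirDeriv (0, 1) (gCurv g) p
      = Real.exp p.2 * (gArc g (gArc g (gCurv g)) p + gCurv g p ^ 3 + gCurv g p) := by
  have hk := h.curv_smooth
  have hks := h.arc_smooth hk
  have hTs := h.arc_smooth h.tangent_smooth
  have hN := h.normal_smooth
  have e0 : dirDeriv (0, 1) (gTangent g)
      = fun p => (Real.exp p.2 • gArc g (gCurv g) p) • gNormal g p :=
    funext h.dirDeriv_snd_tangent
  have hs : ContDiff ℝ ∞ fun p : ℝ × ℝ => Real.exp p.2 • gArc g (gCurv g) p :=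
    exp_snd_smooth.smul hks
  have h1 : inner ℝ (dirDeriv (0, 1) (gNormal g) p) (g p) = -(Real.exp p.2 * gCurv g p) := by
    rw [dirDeriv_inner_const hN h.smooth (fun q => by rw [real_inner_comm, inner_normal]),
      h.flow_normal, inner_smul_right, h.normal_normal, mul_one]
  have h2 : inner ℝ (dirDeriv (0, 1) (gNormal g) p) (gNormal g p) = (0 : ℝ) := by
    have := dirDeriv_inner_const hN hN h.normal_normal (0, 1) p
    rw [real_inner_comm (dirDeriv (0, 1) (gNormal g) p)] at this
    linarith
  have e1 : gCurv g = fun q => inner ℝ (gArc g (gTangent g) q) (gNormal g q) := rfl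
  conv_lhs => rw [e1]
  rw [dirDeriv_inner hTs hN, real_inner_comm, h.dirDeriv_snd_arc h.tangent_smooth, e0,
    arc_smul hs hN, arc_smul exp_snd_smooth hks, arc_exp_snd, h.arc_normal, h.arc_tangent]
  simp only [inner_add_left, inner_add_right, inner_smul_left, inner_smul_right, inner_neg_left,
    inner_neg_right, h1, h2, h.normal_normal, tangent_normal, inner_normal]
  simp
  ring

lemma dirDeriv_snd_arc_curv (h : IsLogFlow g) (p : ℝ × ℝ) :
    dirDeriv (0, 1) (gArc g (gCurv g)) p
      = Real.exp p.2 * (gArc g (gArc g (gArc g (gCurv g))) p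
        + 4 * gCurv g p ^ 2 * gArc g (gCurv g) p + gArc g (gCurv g) p) := by
  have hk := h.curv_smooth
  have hkss := h.arc_smooth (h.arc_smooth hk)
  have e0 : dirDeriv (0, 1) (gCurv g)
      = fun p => Real.exp p.2 • ((gArc g (gArc g (gCurv g)) p + gCurv g p ^ 3) + gCurv g p) :=
    funext h.dirDeriv_snd_curv
  have e3 : gArc g (fun q => gCurv g q ^ 3) p = 3 * gCurv g p ^ 2 * gArc g (gCurv g) p := by
    rw [gArc, dirDeriv_pow hk, gArc]; simp; ring
  have hs1 : ContDiff ℝ ∞ fun q => gArc g (gArc g (gCurv g)) q + gCurv g q ^ 3 :=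
    hkss.add (hk.pow 3)
  rw [h.dirDeriv_snd_arc hk, e0, arc_smul exp_snd_smooth (hs1.add hk), arc_exp_snd,
    arc_add hs1 hk, arc_add hkss (hk.pow 3), e3]
  simp only [smul_eq_mul]
  ring

end IsLogFlow

end Flow

section CauchySchwarz

/-- The Cauchy–Schwarz inequality with a continuous weight. -/
lemma sq_integral_mul_le {f h v : ℝ → ℝ} (hf : Continuous f) (hh : Continuous h)
    (hv : Continuous v) (hv0 : ∀ x, 0 ≤ v x) {a b : ℝ} (hab : a ≤ b) :
    (∫ x in a..b, f x * h x * v x) ^ 2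
      ≤ (∫ x in a..b, f x ^ 2 * v x) * ∫ x in a..b, h x ^ 2 * v x := by
  have key : ∀ c : ℝ, 0 ≤ (∫ x in a..b, h x ^ 2 * v x) * (c * c)
      + (2 * ∫ x in a..b, f x * h x * v x) * c + ∫ x in a..b, f x ^ 2 * v x := by
    intro c
    have h0 : 0 ≤ ∫ x in a..b, (c * h x + f x) ^ 2 * v x :=
      intervalIntegral.integral_nonneg hab fun x _ => mul_nonneg (sq_nonneg _) (hv0 x)
    have e : (fun x => (c * h x + f x) ^ 2 * v x) = fun x =>
        (c * c) * (h x ^ 2 * v x) + (2 * c) * (f x * h x * v x) + f x ^ 2 * v x := by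
      funext x; ring
    rw [e, intervalIntegral.integral_add, intervalIntegral.integral_add,
      intervalIntegral.integral_const_mul, intervalIntegral.integral_const_mul] at h0
    · linarith
    all_goals exact (by fun_prop : Continuous _).intervalIntegrable _ _
  have := discrim_le_zero key
  rw [discrim] at this
  nlinarith

lemma sq_integral_sub_le {f v : ℝ → ℝ} (hf : Continuous f) (hv : Continuous v)
    (hv0 : ∀ x, 0 ≤ v x) {a b c d : ℝ} (hab : a ≤ b) (hc : c ∈ Set.Icc a b)
    (hd : d ∈ Set.Icc a b) :
    |∫ x in c..d, |f x| * v x| ^ 2 ≤ (∫ x in a..b, v x) * ∫ x in a..b, f x ^ 2 * v x := by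
  have hi : Continuous fun x => |f x| * v x := by fun_prop
  have h1 : |∫ x in c..d, |f x| * v x| ≤ |∫ x in a..b, |f x| * v x| := by
    apply intervalIntegral.abs_integral_mono_interval
    · rw [Set.uIoc_of_le hab]
      exact Set.Ioc_subset_Ioc (le_min hc.1 hd.1) (max_le hc.2 hd.2)
    · exact Filter.Eventually.of_forall fun x => mul_nonneg (abs_nonneg _) (hv0 x)
    · exact hi.intervalIntegrable _ _
  have h2 := sq_integral_mul_le continuous_const hf.abs hv hv0 hab (f := fun _ => (1 : ℝ))
  simp only [one_mul, one_pow, sq_abs] at h2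
  refine le_trans ?_ h2
  rw [← sq_abs (∫ x in a..b, |f x| * v x)]
  gcongr

end CauchySchwarz

section Functionals

/-- The length, in logarithmic time. -/
def gLength (g : ℝ × ℝ → EuclideanSpace ℝ (Fin 3)) (τ : ℝ) : ℝ :=
  ∫ u in (0 : ℝ)..(2 * π), gSpeed g (u, τ)

/-- The total curvature `∫ κ ds`. -/
def gTotal (g : ℝ × ℝ → EuclideanSpace ℝ (Fin 3)) (τ : ℝ) : ℝ :=
  ∫ u in (0 : ℝ)..(2 * π), gCurv g (u, τ) * gSpeed g (u, τ)

/-- The energy `∫ f² ds`. -/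
def gEnergy (g : ℝ × ℝ → EuclideanSpace ℝ (Fin 3)) (f : ℝ × ℝ → ℝ) (τ : ℝ) : ℝ :=
  ∫ u in (0 : ℝ)..(2 * π), f (u, τ) ^ 2 * gSpeed g (u, τ)

variable {g : ℝ × ℝ → EuclideanSpace ℝ (Fin 3)}

namespace IsLogFlow

lemma slice_continuous {V : Type*} [NormedAddCommGroup V] [NormedSpace ℝ V] {f : ℝ × ℝ → V}
    (hf : ContDiff ℝ ∞ f) (τ : ℝ) : Continuous fun u => f (u, τ) := by
  have := hf.continuous
  fun_prop

lemma length_pos (h : IsLogFlow g) (τ : ℝ) : 0 < gLength g τ := by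
  apply intervalIntegral.intervalIntegral_pos_of_pos_on
  · exact (slice_continuous h.speed_smooth τ).intervalIntegrable _ _
  · exact fun u _ => h.speed_pos _
  · positivity

lemma energy_nonneg (h : IsLogFlow g) (f : ℝ × ℝ → ℝ) (τ : ℝ) : 0 ≤ gEnergy g f τ :=
  intervalIntegral.integral_nonneg (by positivity)
    fun u _ => mul_nonneg (sq_nonneg _) (h.speed_pos _).le

lemma total_sq_le (h : IsLogFlow g) (τ : ℝ) :
    gTotal g τ ^ 2 ≤ gLength g τ * gEnergy g (gCurv g) τ := by
  have h2 := sq_integral_mul_le (f := fun _ => (1 : ℝ)) continuous_const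
    (slice_continuous h.curv_smooth τ) (slice_continuous h.speed_smooth τ)
    (fun u => (h.speed_pos _).le) (by positivity : (0 : ℝ) ≤ 2 * π)
  simp only [one_mul, one_pow] at h2
  exact h2

lemma hasDerivAt_length (h : IsLogFlow g) (τ : ℝ) :
    HasDerivAt (gLength g) (Real.exp τ * -gEnergy g (gCurv g) τ) τ := by
  refine (hasDerivAt_integral_fst h.speed_smooth 0 (2 * π) τ).congr_deriv ?_
  rw [gEnergy, ← intervalIntegral.integral_neg, ← intervalIntegral.integral_const_mul]
  congr 1
  funext u
  rw [h.dirDeriv_snd_speed]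
  ring

/-- Differentiating a weighted integral, discarding an exact `u`-derivative. -/
lemma hasDerivAt_integral_mul_speed (h : IsLogFlow g) {f q r : ℝ × ℝ → ℝ} (hf : ContDiff ℝ ∞ f)
    (hq : ContDiff ℝ ∞ q) (hr : ContDiff ℝ ∞ r)
    (hper : ∀ u τ, q (u + 2 * π, τ) = q (u, τ))
    (heq : ∀ p, dirDeriv (0, 1) f p - Real.exp p.2 * gCurv g p ^ 2 * f p
      = Real.exp p.2 * (gArc g q p + r p)) (τ : ℝ) :
    HasDerivAt (fun σ => ∫ u in (0 : ℝ)..(2 * π), f (u, σ) * gSpeed g (u, σ))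
      (Real.exp τ * ∫ u in (0 : ℝ)..(2 * π), r (u, τ) * gSpeed g (u, τ)) τ := by
  have hv := h.speed_smooth
  convert hasDerivAt_integral_fst (hf.mul hv) 0 (2 * π) τ using 1
  have e : ∀ u, dirDeriv (0, 1) (fun p => f p * gSpeed g p) (u, τ)
      = Real.exp τ * dirDeriv (1, 0) q (u, τ) + Real.exp τ * (r (u, τ) * gSpeed g (u, τ)) := by
    intro u
    have := heq (u, τ)
    simp only at this
    rw [dirDeriv_mul hf hv, h.dirDeriv_snd_speed, h.dirDeriv_fst_eq q, smul_eq_mul]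
    linear_combination gSpeed g (u, τ) * this
  have c1 := slice_continuous (contDiff_dirDeriv hq (1, 0)) τ
  have c2 := slice_continuous (hr.mul hv) τ
  change _ = ∫ u in (0 : ℝ)..(2 * π), dirDeriv (0, 1) (fun p => f p * gSpeed g p) (u, τ)
  simp only [e]
  rw [intervalIntegral.integral_add (by exact (c1.const_mul _).intervalIntegrable _ _)
    (by exact (c2.const_mul _).intervalIntegrable _ _), intervalIntegral.integral_const_mul,
    intervalIntegral.integral_const_mul, integral_dirDeriv_fst_of_periodic hq hper]
  ring

lemma arc_mul {a b : ℝ × ℝ → ℝ} (ha : ContDiff ℝ ∞ a) (hb : ContDiff ℝ ∞ b) (p : ℝ × ℝ) :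
    gArc g (fun q => a q * b q) p = a p * gArc g b p + gArc g a p * b p :=
  arc_smul ha hb p

lemma hasDerivAt_total (h : IsLogFlow g) (τ : ℝ) :
    HasDerivAt (gTotal g) (Real.exp τ * gTotal g τ) τ := by
  have hk := h.curv_smooth
  have hks := h.arc_smooth hk
  refine h.hasDerivAt_integral_mul_speed hk hks hk (h.arc_periodic hk h.curv_periodic) ?_ τ
  intro p
  rw [h.dirDeriv_snd_curv]
  ring

lemma integral_linear {f₁ f₂ f₃ : ℝ × ℝ → ℝ} (h : IsLogFlow g) (h₁ : ContDiff ℝ ∞ f₁)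
    (h₂ : ContDiff ℝ ∞ f₂) (h₃ : ContDiff ℝ ∞ f₃) (c : ℝ) (τ : ℝ) :
    ∫ u in (0 : ℝ)..(2 * π),
        (-2 * f₁ (u, τ) ^ 2 + c * f₂ (u, τ) ^ 2 + 2 * f₃ (u, τ) ^ 2) * gSpeed g (u, τ)
      = -2 * gEnergy g f₁ τ + c * gEnergy g f₂ τ + 2 * gEnergy g f₃ τ := by
  have c₁ := slice_continuous h₁ τ
  have c₂ := slice_continuous h₂ τ
  have c₃ := slice_continuous h₃ τ
  have cv := slice_continuous h.speed_smooth τ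
  simp only [gEnergy]
  rw [← intervalIntegral.integral_const_mul, ← intervalIntegral.integral_const_mul,
    ← intervalIntegral.integral_const_mul, ← intervalIntegral.integral_add,
    ← intervalIntegral.integral_add]
  · congr 1
    funext u
    ring
  all_goals exact (by fun_prop : Continuous _).intervalIntegrable _ _

lemma hasDerivAt_energy_curv (h : IsLogFlow g) (τ : ℝ) :
    HasDerivAt (gEnergy g (gCurv g)) (Real.exp τ * (-2 * gEnergy g (gArc g (gCurv g)) τ
      + 1 * gEnergy g (fun p => gCurv g p * gCurv g p) τ + 2 * gEnergy g (gCurv g) τ)) τ := by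
  have hk := h.curv_smooth
  have hks := h.arc_smooth hk
  have hper := h.curv_periodic
  have hpers := h.arc_periodic hk hper
  rw [← h.integral_linear hks (hk.mul hk) hk 1 τ]
  refine h.hasDerivAt_integral_mul_speed (hk.pow 2) (q := fun p => gCurv g p * gArc g (gCurv g) p
    + gCurv g p * gArc g (gCurv g) p) (r := fun p => -2 * gArc g (gCurv g) p ^ 2
    + 1 * (gCurv g p * gCurv g p) ^ 2 + 2 * gCurv g p ^ 2) (by fun_prop) (by fun_prop)
    (fun u σ => by simp only [hper, hpers]) ?_ τ
  intro p
  rw [dirDeriv_pow hk, h.dirDeriv_snd_curv, arc_add (hk.mul hks) (hk.mul hks), arc_mul hk hks]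
  norm_num
  ring

lemma hasDerivAt_energy_arc_curv (h : IsLogFlow g) (τ : ℝ) :
    HasDerivAt (gEnergy g (gArc g (gCurv g)))
      (Real.exp τ * (-2 * gEnergy g (gArc g (gArc g (gCurv g))) τ
      + 7 * gEnergy g (fun p => gCurv g p * gArc g (gCurv g) p) τ
      + 2 * gEnergy g (gArc g (gCurv g)) τ)) τ := by
  have hk := h.curv_smooth
  have hks := h.arc_smooth hk
  have hkss := h.arc_smooth hks
  have hpers := h.arc_periodic hk h.curv_periodic
  have hperss := h.arc_periodic hks hpers
  rw [← h.integral_linear hkss (hk.mul hks) hks 7 τ]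
  refine h.hasDerivAt_integral_mul_speed (hks.pow 2)
    (q := fun p => gArc g (gCurv g) p * gArc g (gArc g (gCurv g)) p
      + gArc g (gCurv g) p * gArc g (gArc g (gCurv g)) p)
    (r := fun p => -2 * gArc g (gArc g (gCurv g)) p ^ 2
      + 7 * (gCurv g p * gArc g (gCurv g) p) ^ 2 + 2 * gArc g (gCurv g) p ^ 2)
    (by fun_prop) (by fun_prop) (fun u σ => by simp only [hpers, hperss]) ?_ τ
  intro p
  rw [dirDeriv_pow hks, h.dirDeriv_snd_arc_curv, arc_add (hks.mul hkss) (hks.mul hkss),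
    arc_mul hks hkss]
  norm_num
  ring

lemma curv_sq_le (h : IsLogFlow g) {τ : ℝ} (h0 : gTotal g τ = 0) {u : ℝ}
    (hu : u ∈ Set.Icc (0 : ℝ) (2 * π)) :
    gCurv g (u, τ) ^ 2 ≤ gLength g τ * gEnergy g (gArc g (gCurv g)) τ := by
  have hk := h.curv_smooth
  have hks := h.arc_smooth hk
  have cv := slice_continuous h.speed_smooth τ
  have ck := slice_continuous hk τ
  have cks := slice_continuous hks τ
  have ckv : Continuous fun u => gCurv g (u, τ) * gSpeed g (u, τ) := by fun_prop
  have hpi : (0 : ℝ) < 2 * π := by positivity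
  obtain ⟨c, hc, hc'⟩ := exists_hasDerivAt_eq_slope
    (fun u => ∫ w in (0 : ℝ)..u, gCurv g (w, τ) * gSpeed g (w, τ)) _ hpi
    (continuousOn_of_forall_continuousAt fun x _ =>
      (intervalIntegral.integral_hasDerivAt_right (ckv.intervalIntegrable _ _)
      (ckv.stronglyMeasurableAtFilter _ _) ckv.continuousAt).continuousAt)
    (fun x _ => intervalIntegral.integral_hasDerivAt_right (ckv.intervalIntegrable _ _)
      (ckv.stronglyMeasurableAtFilter _ _) ckv.continuousAt)
  have hz : gCurv g (c, τ) = 0 := by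
    rw [gTotal] at h0
    rw [h0] at hc'
    simp at hc'
    exact hc'.resolve_right (h.speed_pos _).ne'
  have h1 : ∫ w in c..u, gArc g (gCurv g) (w, τ) * gSpeed g (w, τ) = gCurv g (u, τ) := by
    rw [intervalIntegral.integral_eq_sub_of_hasDerivAt (f := fun w => gCurv g (w, τ)), hz, sub_zero]
    · intro x _
      have := hasDerivAt_fst hk x τ
      rwa [h.dirDeriv_fst_eq, smul_eq_mul, mul_comm] at this
    · exact (cks.mul cv).intervalIntegrable _ _
  have h2 := sq_integral_sub_le cks cv (fun x => (h.speed_pos _).le) hpi.le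
    (Set.Ioo_subset_Icc_self hc) hu
  refine le_trans ?_ h2
  rw [← sq_abs (gCurv g (u, τ)), ← h1]
  have h3 := intervalIntegral.norm_integral_le_abs_integral_norm (μ := volume) (a := c) (b := u)
    (f := fun w => gArc g (gCurv g) (w, τ) * gSpeed g (w, τ))
  simp only [norm_mul, Real.norm_eq_abs, abs_of_pos (h.speed_pos _)] at h3
  gcongr

lemma energy_mul_le (h : IsLogFlow g) {τ : ℝ} (h0 : gTotal g τ = 0) {f : ℝ × ℝ → ℝ}
    (hf : ContDiff ℝ ∞ f) :
    gEnergy g (fun p => gCurv g p * f p) τ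
      ≤ gLength g τ * gEnergy g (gArc g (gCurv g)) τ * gEnergy g f τ := by
  have cv := slice_continuous h.speed_smooth τ
  have ck := slice_continuous h.curv_smooth τ
  have cf := slice_continuous hf τ
  rw [gEnergy, gEnergy.eq_def g f, ← intervalIntegral.integral_const_mul]
  apply intervalIntegral.integral_mono_on (by positivity)
    ((by fun_prop : Continuous _).intervalIntegrable _ _)
    ((by fun_prop : Continuous _).intervalIntegrable _ _)
  intro u hu
  have := h.curv_sq_le h0 hu
  have hv := h.speed_pos (u, τ)
  rw [mul_pow, mul_assoc]
  gcongr

/-- Integration by parts: `∫ κ_s² = -∫ κ κ_ss`. -/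
lemma energy_arc_eq (h : IsLogFlow g) (τ : ℝ) :
    gEnergy g (gArc g (gCurv g)) τ = -∫ u in (0 : ℝ)..(2 * π),
      gCurv g (u, τ) * gArc g (gArc g (gCurv g)) (u, τ) * gSpeed g (u, τ) := by
  have hk := h.curv_smooth
  have hks := h.arc_smooth hk
  have hkss := h.arc_smooth hks
  have cv := slice_continuous h.speed_smooth τ
  have ck := slice_continuous hk τ
  have cks := slice_continuous hks τ
  have ckss := slice_continuous hkss τ
  have h1 := integral_dirDeriv_fst_of_periodic (hk.mul hks)
    (fun u τ => by simp only [h.curv_periodic, h.arc_periodic hk h.curv_periodic]) τ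
  have e : ∀ u, dirDeriv (1, 0) (fun p => gCurv g p * gArc g (gCurv g) p) (u, τ)
      = gCurv g (u, τ) * gArc g (gArc g (gCurv g)) (u, τ) * gSpeed g (u, τ)
        + gArc g (gCurv g) (u, τ) ^ 2 * gSpeed g (u, τ) := by
    intro u
    rw [h.dirDeriv_fst_eq, arc_mul hk hks, smul_eq_mul]
    ring
  simp only [e] at h1
  rw [intervalIntegral.integral_add ((by fun_prop : Continuous _).intervalIntegrable _ _)
    ((by fun_prop : Continuous _).intervalIntegrable _ _)] at h1
  rw [gEnergy]
  linarith

lemma energy_arc_sq_le (h : IsLogFlow g) (τ : ℝ) :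
    gEnergy g (gArc g (gCurv g)) τ ^ 2
      ≤ gEnergy g (gCurv g) τ * gEnergy g (gArc g (gArc g (gCurv g))) τ := by
  rw [h.energy_arc_eq, neg_sq]
  exact sq_integral_mul_le (slice_continuous h.curv_smooth τ)
    (slice_continuous (h.arc_smooth (h.arc_smooth h.curv_smooth)) τ)
    (slice_continuous h.speed_smooth τ) (fun u => (h.speed_pos _).le) (by positivity)

end IsLogFlow

end Functionals

section ODE

open Filter Topology

lemma antitoneOn_of_hasDerivAt_neg {L E : ℝ → ℝ} (hL : ∀ t > 0, HasDerivAt L (-E t) t)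
    (hE : ∀ t > 0, 0 ≤ E t) : AntitoneOn L (Set.Ioi 0) := by
  apply antitoneOn_of_deriv_nonpos (convex_Ioi 0)
    (fun x hx => (hL x hx).continuousAt.continuousWithinAt)
  · rw [interior_Ioi]
    exact fun x hx => (hL x hx).differentiableAt.differentiableWithinAt
  · rw [interior_Ioi]
    intro x hx
    rw [(hL x hx).deriv]
    exact neg_nonpos.2 (hE x hx)

/-- A solution of `A' = A` whose square is dominated by minus the derivative of a positive
function vanishes. -/
lemma eq_zero_of_deriv_eq_self {L A E : ℝ → ℝ} (hL : ∀ t > 0, HasDerivAt L (-E t) t)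
    (hA : ∀ t > 0, HasDerivAt A (A t) t) (hLpos : ∀ t > 0, 0 < L t) (hE : ∀ t > 0, 0 ≤ E t)
    (hAE : ∀ t > 0, A t ^ 2 ≤ L t * E t) : ∀ t > 0, A t = 0 := by
  intro t₀ ht₀
  by_contra hne
  have hexp : ∀ t ≥ t₀, A t * Real.exp (-t) = A t₀ * Real.exp (-t₀) := by
    intro t ht
    have hd : ∀ x ∈ Set.Icc t₀ t, HasDerivAt (fun s => A s * Real.exp (-s)) 0 x := by
      intro x hx
      have h1 := (hA x (ht₀.trans_le hx.1)).mul ((hasDerivAt_neg x).exp)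
      exact h1.congr_deriv (by ring)
    exact constant_of_has_deriv_right_zero
      (fun x hx => (hd x hx).continuousAt.continuousWithinAt)
      (fun x hx => (hd x (Set.Ico_subset_Icc_self hx)).hasDerivWithinAt) t ⟨ht, le_rfl⟩
  have hanti : ∀ t ≥ t₀, L t ≤ L t₀ := fun t ht =>
    antitoneOn_of_hasDerivAt_neg hL hE ht₀ (Set.mem_Ioi.2 (ht₀.trans_le ht)) ht
  have hL0 := hLpos t₀ ht₀
  have hElow : ∀ t ≥ t₀, A t₀ ^ 2 / L t₀ ≤ E t := by
    intro t ht
    have ht' := ht₀.trans_le ht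
    have h1 : A t = A t₀ * Real.exp (t - t₀) := by
      rw [sub_eq_add_neg, Real.exp_add, mul_comm (Real.exp t), ← mul_assoc, ← hexp t ht, mul_assoc,
        ← Real.exp_add]
      simp
    have h2 : A t₀ ^ 2 ≤ A t ^ 2 := by
      rw [h1, mul_pow]
      have : 1 ≤ Real.exp (t - t₀) := Real.one_le_exp (by linarith)
      nlinarith [sq_nonneg (A t₀), one_le_pow₀ this (n := 2)]
    rw [div_le_iff₀ hL0]
    nlinarith [hAE t ht', hanti t ht, hE t ht']
  set c := A t₀ ^ 2 / L t₀
  have hc : 0 < c := by positivity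
  set t₁ := t₀ + L t₀ / c
  have ht₁ : t₀ ≤ t₁ := by
    have : 0 < L t₀ / c := by positivity
    simp only [t₁]; linarith
  have := image_le_of_deriv_right_le_deriv_boundary (f := L) (f' := fun t => -E t)
    (B := fun x => L t₀ - c * (x - t₀)) (B' := fun _ => -c) (a := t₀) (b := t₁)
    (fun x hx => (hL x (ht₀.trans_le hx.1)).continuousAt.continuousWithinAt)
    (fun x hx => (hL x (ht₀.trans_le hx.1)).hasDerivWithinAt) (by simp) (by fun_prop)
    (fun x _ => by
      have := ((((hasDerivAt_id x).sub_const t₀).const_mul c).const_sub (L t₀)).hasDerivWithinAt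
        (s := Set.Ici x)
      simpa using this)
    (fun x hx => neg_le_neg (hElow x hx.1)) (x := t₁) ⟨ht₁, le_rfl⟩
  have h3 := hLpos t₁ (ht₀.trans_le ht₁)
  have e : c * (t₁ - t₀) = L t₀ := by
    simp only [t₁]
    field_simp
    ring
  simp only [e] at this
  linarith

/-- Decay of a quantity with `Φ' ≤ -δ Φ`. -/
lemma le_exp_of_deriv_le {Φ Φ' : ℝ → ℝ} {δ T : ℝ} (hΦ : ∀ t ≥ T, HasDerivAt Φ (Φ' t) t)
    (hle : ∀ t ≥ T, Φ' t ≤ -δ * Φ t) : ∀ t ≥ T, Φ t ≤ Φ T * Real.exp (δ * T) * Real.exp (-δ * t) := by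
  intro t ht
  have hd : ∀ x ≥ T, HasDerivAt (fun s => Φ s * Real.exp (δ * s))
      (Φ' x * Real.exp (δ * x) + Φ x * (Real.exp (δ * x) * (δ * 1))) x := fun x hx =>
    (hΦ x hx).mul (((hasDerivAt_id x).const_mul δ).exp)
  have := image_le_of_deriv_right_le_deriv_boundary (f := fun s => Φ s * Real.exp (δ * s))
    (B := fun _ => Φ T * Real.exp (δ * T)) (B' := fun _ => 0) (a := T) (b := t)
    (fun x hx => (hd x hx.1).continuousAt.continuousWithinAt)
    (fun x hx => (hd x hx.1).hasDerivWithinAt) le_rfl continuousOn_const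
    (fun x _ => hasDerivWithinAt_const _ _ _)
    (fun x hx => by nlinarith [hle x hx.1, Real.exp_pos (δ * x)]) (x := t) ⟨ht, le_rfl⟩
  have e : Real.exp (δ * t) * Real.exp (-δ * t) = 1 := by rw [← Real.exp_add]; simp
  calc Φ t = Φ t * Real.exp (δ * t) * Real.exp (-δ * t) := by rw [mul_assoc, e, mul_one]
    _ ≤ _ := by gcongr

/-- If the energy `E = -L'` satisfies `E' ≤ 2 E` as long as it is small, then it tends to `0`. -/
lemma energy_tendsto_zero {L E E' : ℝ → ℝ} {m : ℝ} (hm : 0 < m)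
    (hL : ∀ t > 0, HasDerivAt L (-E t) t) (hLpos : ∀ t > 0, 0 < L t) (hE : ∀ t > 0, 0 ≤ E t)
    (hE' : ∀ t > 0, HasDerivAt E (E' t) t) (hbd : ∀ t ≥ 1, E t ≤ m → E' t ≤ 2 * E t) :
    Tendsto E atTop (𝓝 0) := by
  have hanti := antitoneOn_of_hasDerivAt_neg hL hE
  have hlim : ∃ l, Tendsto L atTop (𝓝 l) := by
    have hanti' : Antitone fun t => L (max t 1) := fun x y hxy =>
      hanti (lt_of_lt_of_le one_pos (le_max_right x 1)) (lt_of_lt_of_le one_pos (le_max_right y 1))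
        (max_le_max hxy le_rfl)
    refine ⟨_, (tendsto_atTop_ciInf hanti' ⟨0, ?_⟩).congr' ?_⟩
    · rintro _ ⟨x, rfl⟩
      exact (hLpos _ (lt_of_lt_of_le one_pos (le_max_right x 1))).le
    · filter_upwards [eventually_ge_atTop 1] with t ht
      rw [max_eq_left ht]
  obtain ⟨l, hl⟩ := hlim
  have hdiff : Tendsto (fun t => L (t - 1) - L t) atTop (𝓝 0) := by
    have h1 : Tendsto (fun t : ℝ => t - 1) atTop atTop :=
      tendsto_atTop_add_const_right _ (-1) tendsto_id
    simpa using (hl.comp h1).sub hl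
  have hbound : ∀ᶠ t in atTop, E t ≤ Real.exp 3 * (L (t - 1) - L t + Real.exp (-t)) := by
    have hexp : Tendsto (fun t : ℝ => Real.exp (-t)) atTop (𝓝 0) :=
      Real.tendsto_exp_neg_atTop_nhds_zero
    have h0 : Tendsto (fun t => Real.exp 3 * (L (t - 1) - L t + Real.exp (-t))) atTop (𝓝 0) := by
      simpa using (hdiff.add hexp).const_mul (Real.exp 3)
    filter_upwards [h0.eventually (gt_mem_nhds hm), eventually_gt_atTop 2] with t ht ht1
    set η := L (t - 1) - L t + Real.exp (-t)
    obtain ⟨s, hs, hs'⟩ := exists_hasDerivAt_eq_slope L (fun t => -E t)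
      (show t - 1 < t by linarith)
      (fun x hx => (hL x (by linarith [hx.1])).continuousAt.continuousWithinAt)
      (fun x hx => hL x (by linarith [hx.1]))
    have hEs : E s = L (t - 1) - L t := by
      have : t - (t - 1) = 1 := by ring
      rw [this, div_one] at hs'
      linarith
    have hs0 : 0 < s := by linarith [hs.1]
    have hη : 0 < η := by
      have := hE s hs0
      have := Real.exp_pos (-t)
      simp only [η]; linarith
    have key := image_le_of_deriv_right_lt_deriv_boundary' (f := E) (f' := E') (a := s) (b := t)
      (B := fun x => η * Real.exp (3 * (x - s)))
      (B' := fun x => η * (Real.exp (3 * (x - s)) * (3 * 1)))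
      (fun x hx => (hE' x (hs0.trans_le hx.1)).continuousAt.continuousWithinAt)
      (fun x hx => (hE' x (hs0.trans_le hx.1)).hasDerivWithinAt)
      (by simp only [sub_self, mul_zero, Real.exp_zero, mul_one, hEs, η]
          linarith [Real.exp_pos (-t)])
      (by fun_prop)
      (fun x _ => ((((hasDerivAt_id x).sub_const s).const_mul 3).exp.const_mul η).hasDerivWithinAt)
      (fun x hx hx' => by
        have hx0 := hs0.trans_le hx.1
        have hexp3 : Real.exp (3 * (x - s)) ≤ Real.exp 3 :=
          Real.exp_le_exp.2 (by linarith [hx.2, hs.1])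
        have := hbd x (by linarith [hx.1, hs.1]) (by rw [hx']; nlinarith)
        have hp : 0 < η * Real.exp (3 * (x - s)) := by positivity
        rw [hx'] at this
        linarith)
      (x := t) ⟨hs.2.le, le_rfl⟩
    refine key.trans ?_
    rw [mul_comm (Real.exp 3)]
    have : Real.exp (3 * (t - s)) ≤ Real.exp 3 := Real.exp_le_exp.2 (by linarith [hs.1])
    gcongr
  have h0 : Tendsto (fun t => Real.exp 3 * (L (t - 1) - L t + Real.exp (-t))) atTop (𝓝 0) := by
    simpa using (hdiff.add Real.tendsto_exp_neg_atTop_nhds_zero).const_mul (Real.exp 3)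
  refine squeeze_zero' ?_ hbound h0
  filter_upwards [eventually_gt_atTop 0] with t ht using hE t ht

/-- The system of differential inequalities satisfied by length, energy and energy of the
derivative of the curvature forces convergence. -/
lemma length_tendsto_and_decay {L E E' D D' : ℝ → ℝ}
    (hL : ∀ t > 0, HasDerivAt L (-E t) t) (hLpos : ∀ t > 0, 0 < L t)
    (hE : ∀ t > 0, 0 ≤ E t) (hD : ∀ t > 0, 0 ≤ D t)
    (hE' : ∀ t > 0, HasDerivAt E (E' t) t) (hD' : ∀ t > 0, HasDerivAt D (D' t) t)
    (hEle : ∀ t > 0, E' t ≤ -2 * D t + L t * D t * E t + 2 * E t)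
    (hDle : ∀ t > 0, 7 * L t * E t ≤ 1 → D' t ≤ -2 * D t + 4 * E t)
    (hwind : ∀ t > 0, L t * E t ≤ 1 / 2 →
      L t * (1 - L t * E t / 2) ≤ 2 * π ∧ 2 * π * (1 - L t * E t) ≤ L t) :
    Tendsto L atTop (𝓝 (2 * π)) ∧ ∃ T > 0, ∃ C > 0, ∃ δ > 0, ∀ t ≥ T,
      L t * D t ≤ C * Real.exp (-δ * t) := by
  have hanti : ∀ t ≥ 1, ∀ s ≥ t, L s ≤ L t := fun t ht s hs =>
    antitoneOn_of_hasDerivAt_neg hL hE (Set.mem_Ioi.2 (by linarith))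
      (Set.mem_Ioi.2 (by linarith)) hs
  have hL1 := hLpos 1 one_pos
  have hle : ∀ t ≥ 1, L t ≤ L 1 := hanti 1 le_rfl
  have hEzero : Tendsto E atTop (𝓝 0) := by
    refine energy_tendsto_zero (m := 1 / L 1) (by positivity) hL hLpos hE hE' ?_
    intro t ht hEm
    have ht0 : 0 < t := by linarith
    rw [le_div_iff₀ hL1] at hEm
    have h1 : L t * E t ≤ 1 := by nlinarith [hle t ht, hE t ht0]
    nlinarith [hEle t ht0, hD t ht0]
  have hsmall : ∀ᶠ t in atTop, 7 * L 1 * E t < 1 := by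
    have : Tendsto (fun t => 7 * L 1 * E t) atTop (𝓝 0) := by
      simpa using hEzero.const_mul (7 * L 1)
    exact this.eventually (gt_mem_nhds one_pos)
  obtain ⟨T₀, hT₀⟩ := eventually_atTop.1 hsmall
  set T := max T₀ 1
  have hT1 : 1 ≤ T := le_max_right _ _
  have hLE : ∀ t ≥ T, L t * E t ≤ L 1 * E t := fun t ht =>
    mul_le_mul_of_nonneg_right (hle t (by linarith)) (hE t (by linarith))
  have hLE7 : ∀ t ≥ T, 7 * (L t * E t) ≤ 1 := fun t ht => by
    have := hT₀ t (le_trans (le_max_left _ _) ht)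
    linarith [hLE t ht]
  have hup : ∀ t ≥ T, L t - 2 * π ≤ L 1 ^ 2 * E t / 2 := by
    intro t ht
    have h1 := (hwind t (by linarith) (by linarith [hLE7 t ht])).1
    have h2 := hLE t ht
    have h3 := hle t (by linarith)
    have h4 := hLpos t (by linarith)
    have h5 := mul_le_mul h3 h2 (by have := hE t (by linarith); positivity) hL1.le
    linarith
  have hlow : ∀ t ≥ T, 2 * π * (1 - L 1 * E t) ≤ L t := by
    intro t ht
    have h1 := (hwind t (by linarith) (by linarith [hLE7 t ht])).2
    refine le_trans ?_ h1
    have := hLE t ht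
    gcongr
  have hlim : Tendsto L atTop (𝓝 (2 * π)) := by
    refine tendsto_of_tendsto_of_tendsto_of_le_of_le' (g := fun t => 2 * π * (1 - L 1 * E t))
      (h := fun t => 2 * π + L 1 ^ 2 * E t / 2) ?_ ?_ ?_ ?_
    · simpa using ((hEzero.const_mul (L 1)).const_sub 1).const_mul (2 * π)
    · simpa using ((hEzero.const_mul (L 1 ^ 2)).div_const 2).const_add (2 * π)
    · filter_upwards [eventually_ge_atTop T] with t ht using hlow t ht
    · filter_upwards [eventually_ge_atTop T] with t ht
      linarith [hup t ht]
  have hge : ∀ t ≥ T, 2 * π ≤ L t := fun t ht => by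
    refine le_of_tendsto hlim ?_
    filter_upwards [eventually_ge_atTop t] with s hs using hanti t (by linarith) s hs
  refine ⟨hlim, T, by linarith, ?_⟩
  set δ := min 2 (1 / L 1 ^ 2)
  have hδ : 0 < δ := lt_min two_pos (by positivity)
  have hdecay := le_exp_of_deriv_le (Φ := fun t => D t + 8 * (L t - 2 * π))
    (Φ' := fun t => D' t + 8 * -E t) (δ := δ) (T := T)
    (fun t ht => (hD' t (by linarith)).add (((hL t (by linarith)).sub_const (2 * π)).const_mul 8))
    (fun t ht => by
      have h1 := hDle t (by linarith) (by linarith [hLE7 t ht])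
      have h2 := hup t ht
      have h3 := hge t ht
      have h4 : δ * D t ≤ 2 * D t :=
        mul_le_mul_of_nonneg_right (min_le_left _ _) (hD t (by linarith))
      have h5 : δ * (L t - 2 * π) ≤ E t / 2 := by
        calc δ * (L t - 2 * π) ≤ 1 / L 1 ^ 2 * (L t - 2 * π) :=
              mul_le_mul_of_nonneg_right (min_le_right _ _) (by linarith)
          _ ≤ 1 / L 1 ^ 2 * (L 1 ^ 2 * E t / 2) := by gcongr
          _ = E t / 2 := by field_simp
      linarith)
  set M := D T + 8 * (L T - 2 * π)
  refine ⟨L 1 * (M * Real.exp (δ * T)) + 1, ?_, δ, hδ, ?_⟩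
  · have : 0 ≤ M := by
      have h1 := hD T (by linarith)
      have h2 := hge T le_rfl
      simp only [M]
      linarith
    positivity
  · intro t ht
    have h1 := hdecay t ht
    have h2 := hge t ht
    have h3 : D t ≤ M * Real.exp (δ * T) * Real.exp (-δ * t) := by linarith
    have h4 : L t * D t ≤ L 1 * D t :=
      mul_le_mul_of_nonneg_right (hle t (by linarith)) (hD t (by linarith))
    have h5 := mul_le_mul_of_nonneg_left h3 hL1.le
    have h6 := Real.exp_pos (-δ * t)
    linarith

end ODE

section Winding

lemma ne_of_injOn_period {α : Type*} {f : ℝ → α} (hf : Function.Periodic f (2 * π))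
    (hinj : Set.InjOn f (Set.Ico 0 (2 * π))) {a b : ℝ} (hab : a < b) (hb : b < a + 2 * π) :
    f a ≠ f b := by
  intro h
  have hp : (0 : ℝ) < 2 * π := by positivity
  have hmod : ∀ x, f (toIcoMod hp 0 x) = f x := fun x => by
    rw [toIcoMod]
    exact hf.sub_zsmul_eq _
  have hmem : ∀ x, toIcoMod hp 0 x ∈ Set.Ico 0 (2 * π) := fun x => by
    simpa using toIcoMod_mem_Ico hp 0 x
  have := hinj (hmem a) (hmem b) (by simp only [hmod, h])
  obtain ⟨n, hn⟩ := (toIcoMod_eq_toIcoMod hp).1 this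
  rw [zsmul_eq_mul] at hn
  have h1 : (0 : ℝ) < n := by
    by_contra hc
    nlinarith
  have h2 : (n : ℝ) < 1 := by
    by_contra hc
    nlinarith
  have h3 : 0 < n := by exact_mod_cast h1
  have h4 : n < 1 := by exact_mod_cast h2
  omega

/-- If the angle of a periodic curve increases and the total increase exceeds `2π`, then some two
points one turn apart have equal heights. -/
lemma exists_eq_height {φ h : ℝ → ℝ} {Φ p : ℝ} (hp : 0 < p) (hφ : Continuous φ)
    (hmono : StrictMono φ) (hper : ∀ u, φ (u + p) = φ u + Φ) (hh : Continuous h)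
    (hhper : Function.Periodic h p) (hΦ : 2 * π < Φ) :
    ∃ a b, a < b ∧ b < a + p ∧ φ b = φ a + 2 * π ∧ h a = h b := by
  have hpi : (0 : ℝ) < 2 * π := by positivity
  have hex : ∀ u, ∃ w, φ w = φ u + 2 * π := fun u => by
    obtain ⟨w, -, hw⟩ := intermediate_value_Icc (show u ≤ u + p by linarith) hφ.continuousOn
      (show φ u + 2 * π ∈ Set.Icc (φ u) (φ (u + p)) by rw [hper]; constructor <;> linarith)
    exact ⟨w, hw⟩
  choose σ hσ using hex
  have hσmono : Monotone σ := fun a b hab => by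
    rw [← hmono.le_iff_le, hσ, hσ]
    linarith [hmono.monotone hab]
  have hσsurj : Function.Surjective σ := fun w => by
    obtain ⟨u, -, hu⟩ := intermediate_value_Icc (show w - p ≤ w by linarith) hφ.continuousOn
      (show φ w - 2 * π ∈ Set.Icc (φ (w - p)) (φ w) by
        have := hper (w - p)
        rw [sub_add_cancel] at this
        constructor <;> linarith)
    refine ⟨u, hmono.injective ?_⟩
    rw [hσ, hu]
    ring
  have hσc : Continuous σ := hσmono.continuous_of_surjective hσsurj
  have hne : (Set.Icc 0 p).Nonempty := ⟨0, le_rfl, hp.le⟩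
  obtain ⟨M, -, hM⟩ := isCompact_Icc.exists_isMaxOn hne hh.continuousOn
  obtain ⟨m, -, hm⟩ := isCompact_Icc.exists_isMinOn hne hh.continuousOn
  have hred : ∀ u, ∃ w ∈ Set.Icc 0 p, h u = h w := fun u => by
    obtain ⟨w, hw, hw'⟩ := hhper.exists_mem_Ico₀ hp u
    exact ⟨w, Set.Ico_subset_Icc_self hw, hw'⟩
  obtain ⟨a, ha⟩ := mem_range_of_exists_le_of_exists_ge (c := 0)
    ((hh.comp hσc).sub hh)
    ⟨M, by
      obtain ⟨w, hw, hw'⟩ := hred (σ M)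
      have := hM hw
      simp only [Set.mem_ofPred_eq] at this
      show h (σ M) - h M ≤ 0
      rw [hw']
      linarith⟩
    ⟨m, by
      obtain ⟨w, hw, hw'⟩ := hred (σ m)
      have := hm hw
      simp only [Set.mem_ofPred_eq] at this
      show 0 ≤ h (σ m) - h m
      rw [hw']
      linarith⟩
  refine ⟨a, σ a, ?_, ?_, hσ a, ?_⟩
  · rw [← hmono.lt_iff_lt, hσ]; linarith
  · rw [← hmono.lt_iff_lt, hσ, hper]; linarith
  · simp only [Pi.sub_apply, Function.comp_apply] at ha
    linarith

/-- Polar coordinates along a plane curve avoiding the origin. -/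
lemma polar_of_angle {x y x' y' φ ρ : ℝ → ℝ} (hx : ∀ u, HasDerivAt x (x' u) u)
    (hy : ∀ u, HasDerivAt y (y' u) u) (hφ : ∀ u, HasDerivAt φ (ρ u) u)
    (hR : ∀ u, 0 < x u ^ 2 + y u ^ 2)
    (hρ : ∀ u, ρ u * (x u ^ 2 + y u ^ 2) = x u * y' u - y u * x' u)
    (hx0 : 0 < x 0) (hy0 : y 0 = 0) (hφ0 : φ 0 = 0) (u : ℝ) :
    ∃ r > 0, r ^ 2 = x u ^ 2 + y u ^ 2 ∧ x u = r * Real.cos (φ u) ∧ y u = r * Real.sin (φ u) := by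
  set P : ℝ → ℝ := fun u => x u * Real.cos (φ u) + y u * Real.sin (φ u)
  set Q : ℝ → ℝ := fun u => y u * Real.cos (φ u) - x u * Real.sin (φ u)
  have hPQ : ∀ u, P u ^ 2 + Q u ^ 2 = x u ^ 2 + y u ^ 2 := fun u => by
    simp only [P, Q]
    linear_combination (x u ^ 2 + y u ^ 2) * Real.sin_sq_add_cos_sq (φ u)
  have hQ' : ∀ u, HasDerivAt Q (y' u * Real.cos (φ u) + y u * (-Real.sin (φ u) * ρ u)
      - (x' u * Real.sin (φ u) + x u * (Real.cos (φ u) * ρ u))) u := fun u =>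
    ((hy u).mul (hφ u).cos).sub ((hx u).mul (hφ u).sin)
  have hconst : ∀ u, HasDerivAt (fun u => Q u ^ 2 / (x u ^ 2 + y u ^ 2)) 0 u := fun u => by
    have h1 := ((hQ' u).pow 2).div (((hx u).pow 2).add ((hy u).pow 2)) (hR u).ne'
    refine h1.congr_deriv ?_
    have hRu := (hR u).ne'
    rw [div_eq_zero_iff]
    left
    simp only [Q, Pi.pow_apply, Pi.add_apply]
    norm_num
    linear_combination (-2 * (y u * Real.cos (φ u) - x u * Real.sin (φ u))
      * (x u * Real.cos (φ u) + y u * Real.sin (φ u))) * hρ u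
  have hQ0 : ∀ u, Q u = 0 := fun u => by
    have h1 := is_const_of_deriv_eq_zero (fun u => (hconst u).differentiableAt)
      (fun u => (hconst u).deriv) u 0
    have h2 : Q 0 = 0 := by simp [Q, hy0, hφ0]
    rw [h2] at h1
    have := (hR u).ne'
    simpa [this] using h1
  have hPc : Continuous P := continuous_iff_continuousAt.2 fun u =>
    (((hx u).mul (hφ u).cos).add ((hy u).mul (hφ u).sin)).continuousAt
  have hPpos : 0 < P u := by
    by_contra hneg
    obtain ⟨w, hw⟩ := mem_range_of_exists_le_of_exists_ge (c := 0) hPc ⟨u, not_lt.1 hneg⟩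
      ⟨0, by simp [P, hφ0, hx0.le]⟩
    have := hPQ w
    rw [hw, hQ0] at this
    linarith [hR w]
  refine ⟨P u, hPpos, ?_, ?_, ?_⟩
  · rw [← hPQ, hQ0]; ring
  · have := hQ0 u
    simp only [P, Q] at this ⊢
    linear_combination (-x u) * Real.sin_sq_add_cos_sq (φ u) - Real.sin (φ u) * this
  · have := hQ0 u
    simp only [P, Q] at this ⊢
    linear_combination (-y u) * Real.sin_sq_add_cos_sq (φ u) + Real.cos (φ u) * this

end Winding

section LengthBounds

variable {g : ℝ × ℝ → EuclideanSpace ℝ (Fin 3)}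

namespace IsLogFlow

lemma sum_sq_inner (h : IsLogFlow g) (p : ℝ × ℝ) (x : EuclideanSpace ℝ (Fin 3)) :
    inner ℝ x (g p) ^ 2 + inner ℝ x (gTangent g p) ^ 2 + inner ℝ x (gNormal g p) ^ 2
      = (inner ℝ x x : ℝ) := by
  conv_rhs => rw [h.expand p x]
  have h1 := h.inner_tangent p
  have h2 := inner_normal (g := g) p
  have h3 := tangent_normal (g := g) p
  have h1' : inner ℝ (gTangent g p) (g p) = (0 : ℝ) := by rw [real_inner_comm, h1]
  have h2' : inner ℝ (gNormal g p) (g p) = (0 : ℝ) := by rw [real_inner_comm, h2]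
  have h3' : inner ℝ (gNormal g p) (gTangent g p) = (0 : ℝ) := by rw [real_inner_comm, h3]
  simp only [inner_add_left, inner_add_right, inner_smul_left, inner_smul_right, h1, h2, h3, h1',
    h2', h3', h.inner_self, h.tangent_tangent, h.normal_normal]
  simp
  ring

lemma normal_periodic (h : IsLogFlow g) (u τ : ℝ) :
    gNormal g (u + 2 * π, τ) = gNormal g (u, τ) := by
  simp only [gNormal, h.periodic, h.tangent_periodic]

/-- The normal stays close to its initial value when the energy is small. -/
lemma inner_normal_ge (h : IsLogFlow g) (u τ : ℝ) :
    1 - gLength g τ * gEnergy g (gCurv g) τ / 2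
      ≤ inner ℝ (gNormal g (u, τ)) (gNormal g (0, τ)) := by
  have hpi : (0 : ℝ) < 2 * π := by positivity
  have hper : Function.Periodic (fun u => (inner ℝ (gNormal g (u, τ)) (gNormal g (0, τ)) : ℝ))
      (2 * π) := fun u => by simp only [h.normal_periodic]
  obtain ⟨w, hw, hw'⟩ := hper.exists_mem_Ico₀ hpi u
  rw [hw']
  have ck := slice_continuous h.curv_smooth τ
  have cv := slice_continuous h.speed_smooth τ
  have h1 : ∫ x in (0 : ℝ)..w, dirDeriv (1, 0) (gNormal g) (x, τ)
      = gNormal g (w, τ) - gNormal g (0, τ) :=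
    intervalIntegral.integral_eq_sub_of_hasDerivAt
      (fun x _ => hasDerivAt_fst h.normal_smooth x τ)
      ((slice_continuous (contDiff_dirDeriv h.normal_smooth _) τ).intervalIntegrable _ _)
  have hnT : ∀ p, ‖gTangent g p‖ = 1 := fun p => by
    have := h.tangent_tangent p
    rw [real_inner_self_eq_norm_sq] at this
    exact (pow_eq_one_iff_of_nonneg (norm_nonneg _) two_ne_zero).1 this
  have h2 : ‖gNormal g (w, τ) - gNormal g (0, τ)‖
      ≤ |∫ x in (0 : ℝ)..w, |gCurv g (x, τ)| * gSpeed g (x, τ)| := by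
    rw [← h1]
    refine intervalIntegral.norm_integral_le_abs_integral_norm.trans (le_of_eq ?_)
    congr 2
    funext x
    rw [h.dirDeriv_fst_eq, h.arc_normal, norm_smul, norm_neg, norm_smul, hnT, Real.norm_eq_abs,
      Real.norm_eq_abs, abs_of_pos (h.speed_pos _)]
    ring
  have h3 := sq_integral_sub_le ck cv (fun x => (h.speed_pos (x, τ)).le) hpi.le
    ⟨le_rfl, hpi.le⟩ (Set.Ico_subset_Icc_self hw)
  have h4 : ‖gNormal g (w, τ) - gNormal g (0, τ)‖ ^ 2
      ≤ gLength g τ * gEnergy g (gCurv g) τ := le_trans (by gcongr) h3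
  rw [norm_sub_sq_real, ← real_inner_self_eq_norm_sq, ← real_inner_self_eq_norm_sq,
    h.normal_normal, h.normal_normal] at h4
  linarith

/-- A simple closed spherical curve of small energy has length close to `2π`. -/
lemma length_bounds (h : IsLogFlow g) {τ : ℝ}
    (hinj : Set.InjOn (fun u => g (u, τ)) (Set.Ico 0 (2 * π)))
    (hsmall : gLength g τ * gEnergy g (gCurv g) τ ≤ 1 / 2) :
    gLength g τ * (1 - gLength g τ * gEnergy g (gCurv g) τ / 2) ≤ 2 * π ∧
      2 * π * (1 - gLength g τ * gEnergy g (gCurv g) τ) ≤ gLength g τ := by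
  have hpi : (0 : ℝ) < 2 * π := by positivity
  have hn := fun u => h.inner_normal_ge u τ
  have hε0 : 0 ≤ gLength g τ * gEnergy g (gCurv g) τ :=
    mul_nonneg (h.length_pos τ).le (h.energy_nonneg _ τ)
  set ε := gLength g τ * gEnergy g (gCurv g) τ
  set x : ℝ → ℝ := fun u => inner ℝ (g (u, τ)) (g (0, τ))
  set y : ℝ → ℝ := fun u => inner ℝ (g (u, τ)) (gTangent g (0, τ))
  set z : ℝ → ℝ := fun u => inner ℝ (g (u, τ)) (gNormal g (0, τ))
  set n : ℝ → ℝ := fun u => inner ℝ (gNormal g (u, τ)) (gNormal g (0, τ))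
  have cg := slice_continuous h.smooth τ
  have cN := slice_continuous h.normal_smooth τ
  have cv := slice_continuous h.speed_smooth τ
  have cn : Continuous n := cN.inner continuous_const
  have cz : Continuous z := cg.inner continuous_const
  have hxyz : ∀ u, x u ^ 2 + y u ^ 2 + z u ^ 2 = 1 := fun u => by
    rw [← h.inner_self (u, τ)]
    exact h.sum_sq_inner (0, τ) (g (u, τ))
  have hzn : ∀ u, z u ^ 2 + n u ^ 2 ≤ 1 := fun u => by
    have := h.sum_sq_inner (u, τ) (gNormal g (0, τ))
    rw [h.normal_normal, real_inner_comm, real_inner_comm (gNormal g (u, τ))] at this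
    have h0 := sq_nonneg (inner ℝ (gNormal g (0, τ)) (gTangent g (u, τ)) : ℝ)
    change z u ^ 2 + _ + n u ^ 2 = 1 at this
    linarith
  have hn1 : ∀ u, n u ≤ 1 := fun u => by nlinarith [hzn u, sq_nonneg (z u)]
  have hzε : ∀ u, z u ^ 2 ≤ ε := fun u => by
    have := hn u
    change 1 - ε / 2 ≤ n u at this
    nlinarith [hzn u, sq_nonneg ε]
  have hR : ∀ u, 1 - ε ≤ x u ^ 2 + y u ^ 2 := fun u => by linarith [hxyz u, hzε u]
  have hR1 : ∀ u, x u ^ 2 + y u ^ 2 ≤ 1 := fun u => by linarith [hxyz u, sq_nonneg (z u)]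
  have hRpos : ∀ u, 0 < x u ^ 2 + y u ^ 2 := fun u => by linarith [hR u]
  have hx : ∀ u, HasDerivAt x (gSpeed g (u, τ) * inner ℝ (gTangent g (u, τ)) (g (0, τ))) u := by
    intro u
    have := (hasDerivAt_fst h.smooth u τ).inner ℝ (hasDerivAt_const u (g (0, τ)))
    rw [h.dirDeriv_fst_eq, inner_zero_right, zero_add, inner_smul_left] at this
    exact this
  have hy : ∀ u, HasDerivAt y
      (gSpeed g (u, τ) * inner ℝ (gTangent g (u, τ)) (gTangent g (0, τ))) u := by
    intro u
    have := (hasDerivAt_fst h.smooth u τ).inner ℝ (hasDerivAt_const u (gTangent g (0, τ)))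
    rw [h.dirDeriv_fst_eq, inner_zero_right, zero_add, inner_smul_left] at this
    exact this
  have cx : Continuous x := cg.inner continuous_const
  have cy : Continuous y := cg.inner continuous_const
  set ρ : ℝ → ℝ := fun u => gSpeed g (u, τ) * n u / (x u ^ 2 + y u ^ 2)
  have cρ : Continuous ρ :=
    (cv.mul cn).div (by fun_prop) fun u => (hRpos u).ne'
  have hρeq : ∀ u, ρ u * (x u ^ 2 + y u ^ 2)
      = x u * (gSpeed g (u, τ) * inner ℝ (gTangent g (u, τ)) (gTangent g (0, τ)))
        - y u * (gSpeed g (u, τ) * inner ℝ (gTangent g (u, τ)) (g (0, τ))) := fun u => by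
    have e := inner_cross3_cross3 (g (u, τ)) (gTangent g (u, τ)) (g (0, τ)) (gTangent g (0, τ))
    change n u = x u * _ - y u * _ at e
    simp only [ρ]
    rw [div_mul_cancel₀ _ (hRpos u).ne', e]
    ring
  have hnpos : ∀ u, 1 - ε / 2 ≤ n u := hn
  have hρlow : ∀ u, gSpeed g (u, τ) * (1 - ε / 2) ≤ ρ u := fun u => by
    have hv := h.speed_pos (u, τ)
    rw [le_div_iff₀ (hRpos u)]
    have h1 : gSpeed g (u, τ) * (1 - ε / 2) ≤ gSpeed g (u, τ) * n u := by
      gcongr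
      exact hnpos u
    have h2 : 0 ≤ gSpeed g (u, τ) * (1 - ε / 2) := mul_nonneg hv.le (by linarith)
    nlinarith [hR1 u]
  have hρup : ∀ u, (1 - ε) * ρ u ≤ gSpeed g (u, τ) := fun u => by
    have hv := h.speed_pos (u, τ)
    simp only [ρ]
    rw [← mul_div_assoc, div_le_iff₀ (hRpos u)]
    have h1 : gSpeed g (u, τ) * n u ≤ gSpeed g (u, τ) := by nlinarith [hn1 u]
    have h2 : 0 ≤ gSpeed g (u, τ) * n u := mul_nonneg hv.le (by linarith [hnpos u])
    nlinarith [hR u]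
  have hρpos : ∀ u, 0 < ρ u := fun u =>
    lt_of_lt_of_le (mul_pos (h.speed_pos _) (by linarith)) (hρlow u)
  set φ : ℝ → ℝ := fun u => ∫ w in (0 : ℝ)..u, ρ w
  have hφ : ∀ u, HasDerivAt φ (ρ u) u := fun u =>
    intervalIntegral.integral_hasDerivAt_right (cρ.intervalIntegrable _ _)
      (cρ.stronglyMeasurableAtFilter _ _) cρ.continuousAt
  have hφc : Continuous φ := continuous_iff_continuousAt.2 fun u => (hφ u).continuousAt
  have hφmono : StrictMono φ := strictMono_of_deriv_pos fun u => by
    rw [(hφ u).deriv]; exact hρpos u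
  have hφ0 : φ 0 = 0 := intervalIntegral.integral_same
  have hxper : ∀ u, x (u + 2 * π) = x u := fun u => by simp only [x, h.periodic]
  have hyper : ∀ u, y (u + 2 * π) = y u := fun u => by simp only [y, h.periodic]
  have hzper : ∀ u, z (u + 2 * π) = z u := fun u => by simp only [z, h.periodic]
  have hρper : Function.Periodic ρ (2 * π) := fun u => by
    simp only [ρ, hxper, hyper, n, h.normal_periodic, h.speed_periodic]
  have hφper : ∀ u, φ (u + 2 * π) = φ u + φ (2 * π) := fun u => by
    have h1 := hρper.intervalIntegral_add_eq u 0
    rw [zero_add] at h1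
    simp only [φ]
    rw [← h1, intervalIntegral.integral_add_adjacent_intervals] <;>
      exact cρ.intervalIntegrable _ _
  have hx0 : x 0 = 1 := h.inner_self _
  have hy0 : y 0 = 0 := h.inner_tangent _
  have hpolar := polar_of_angle hx hy hφ hRpos hρeq (by rw [hx0]; exact one_pos) hy0 hφ0
  have hΦpos : 0 < φ (2 * π) := by rw [← hφ0]; exact hφmono hpi
  have hΦle : φ (2 * π) ≤ 2 * π := by
    by_contra hgt
    obtain ⟨a, b, hab, hb, hφab, hzab⟩ :=
      exists_eq_height hpi hφc hφmono hφper cz hzper (not_le.1 hgt)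
    refine ne_of_injOn_period (f := fun u => g (u, τ)) (fun u => h.periodic u τ)
      hinj hab hb ?_
    obtain ⟨r, hr, hr2, hrx, hry⟩ := hpolar a
    obtain ⟨s, hs, hs2, hsx, hsy⟩ := hpolar b
    have hrs : r = s := by
      have h1 := hxyz a
      have h2 := hxyz b
      rw [hzab] at h1
      exact (sq_eq_sq₀ hr.le hs.le).1 (by linarith)
    rw [hφab, Real.cos_add_two_pi] at hsx
    rw [hφab, Real.sin_add_two_pi] at hsy
    have hxab : x a = x b := by rw [hrx, hsx, hrs]
    have hyab : y a = y b := by rw [hry, hsy, hrs]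
    have ea := h.expand (0, τ) (g (a, τ))
    have eb := h.expand (0, τ) (g (b, τ))
    change _ = x a • _ + y a • _ + z a • _ at ea
    change _ = x b • _ + y b • _ + z b • _ at eb
    change g (a, τ) = g (b, τ)
    rw [ea, eb, hxab, hyab, hzab]
  have hΦ : φ (2 * π) = 2 * π := by
    obtain ⟨r, hr, hr2, hrx, hry⟩ := hpolar (2 * π)
    have e1 := hxper 0
    have e2 := hyper 0
    rw [zero_add] at e1 e2
    rw [e1, hx0] at hr2 hrx
    rw [e2, hy0] at hr2
    have hr1 : r = 1 := by nlinarith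
    rw [hr1, one_mul] at hrx
    obtain ⟨k, hk⟩ := (Real.cos_eq_one_iff _).1 hrx.symm
    have hkpos : (0 : ℝ) < k := by
      by_contra hc
      nlinarith
    have hk1 : (1 : ℝ) ≤ k := by
      have : 0 < k := by exact_mod_cast hkpos
      exact_mod_cast this
    nlinarith
  have hφ_eq : φ (2 * π) = ∫ w in (0 : ℝ)..(2 * π), ρ w := rfl
  rw [hΦ] at hφ_eq
  constructor
  · rw [hφ_eq, gLength, ← intervalIntegral.integral_mul_const]
    exact intervalIntegral.integral_mono_on hpi.le
      ((cv.mul continuous_const).intervalIntegrable _ _) (cρ.intervalIntegrable _ _)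
      fun u _ => hρlow u
  · rw [mul_comm]
    nth_rewrite 1 [hφ_eq]
    rw [gLength, ← intervalIntegral.integral_const_mul]
    exact intervalIntegral.integral_mono_on hpi.le
      ((continuous_const.mul cρ).intervalIntegrable _ _) (cv.intervalIntegrable _ _)
      fun u _ => hρup u

end IsLogFlow

end LengthBounds

section EnergyEstimates

variable {g : ℝ × ℝ → EuclideanSpace ℝ (Fin 3)}

namespace IsLogFlow

lemma hasDerivAt_comp_log {f : ℝ → ℝ} {c t : ℝ} (ht : 0 < t)
    (hf : HasDerivAt f (Real.exp (Real.log t) * c) (Real.log t)) :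
    HasDerivAt (fun s => f (Real.log s)) c t := by
  refine (hf.comp t (Real.hasDerivAt_log ht.ne')).congr_deriv ?_
  rw [Real.exp_log ht]
  field_simp

/-- An embedded flow in logarithmic time has vanishing total curvature, its length tends to `2π`
and its curvature decays exponentially. -/
lemma length_tendsto_and_curv_decay (h : IsLogFlow g)
    (hinj : ∀ τ, Set.InjOn (fun u => g (u, τ)) (Set.Ico 0 (2 * π))) :
    Filter.Tendsto (fun t => gLength g (Real.log t)) Filter.atTop (nhds (2 * π)) ∧
      ∃ T > (0 : ℝ), ∃ C > (0 : ℝ), ∃ δ > (0 : ℝ), ∀ t ≥ T, ∀ u ∈ Set.Icc (0 : ℝ) (2 * π),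
        gCurv g (u, Real.log t) ^ 2 ≤ C * Real.exp (-δ * t) := by
  have hL : ∀ t > 0, HasDerivAt (fun s => gLength g (Real.log s))
      (-gEnergy g (gCurv g) (Real.log t)) t := fun t ht =>
    hasDerivAt_comp_log ht (h.hasDerivAt_length _)
  have hA : ∀ t > 0, gTotal g (Real.log t) = 0 :=
    eq_zero_of_deriv_eq_self (A := fun s => gTotal g (Real.log s)) hL
      (fun t ht => hasDerivAt_comp_log ht (h.hasDerivAt_total _))
      (fun t _ => h.length_pos _) (fun t _ => h.energy_nonneg _ _) (fun t _ => h.total_sq_le _)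
  obtain ⟨hlim, T, hT, C, hC, δ, hδ, hdec⟩ := length_tendsto_and_decay hL
    (fun t _ => h.length_pos _) (fun t _ => h.energy_nonneg _ _)
    (D := fun s => gEnergy g (gArc g (gCurv g)) (Real.log s)) (fun t _ => h.energy_nonneg _ _)
    (fun t ht => hasDerivAt_comp_log ht (h.hasDerivAt_energy_curv _))
    (fun t ht => hasDerivAt_comp_log ht (h.hasDerivAt_energy_arc_curv _))
    (fun t ht => by linarith [h.energy_mul_le (hA t ht) h.curv_smooth])
    (fun t ht hsmall => by
      have h1 := h.energy_mul_le (hA t ht) (h.arc_smooth h.curv_smooth)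
      have h2 := h.energy_arc_sq_le (Real.log t)
      have hE := h.energy_nonneg (gCurv g) (Real.log t)
      have hD := h.energy_nonneg (gArc g (gCurv g)) (Real.log t)
      have hF := h.energy_nonneg (gArc g (gArc g (gCurv g))) (Real.log t)
      have hl := h.length_pos (Real.log t)
      set l := gLength g (Real.log t)
      set E := gEnergy g (gCurv g) (Real.log t)
      set D := gEnergy g (gArc g (gCurv g)) (Real.log t)
      set F := gEnergy g (gArc g (gArc g (gCurv g))) (Real.log t)
      have h3 : 7 * l * D ^ 2 ≤ F := by
        have h4 : 7 * l * D ^ 2 ≤ 7 * l * (E * F) := by gcongr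
        have h5 : 7 * l * E * F ≤ 1 * F := by gcongr
        linarith
      have h6 : 4 * D - 4 * E ≤ F := by
        rcases hE.eq_or_lt with hE0 | hE0
        · rw [← hE0, zero_mul] at h2
          have : D = 0 := by nlinarith
          linarith
        · by_contra hc
          nlinarith [sq_nonneg (D - 2 * E), mul_pos hE0 (sub_pos.2 (not_le.1 hc))]
      nlinarith)
    (fun t _ hsmall => h.length_bounds (hinj _) hsmall)
  exact ⟨hlim, max T 1, by positivity, C, hC, δ, hδ, fun t ht u hu =>
    (h.curv_sq_le (hA t (by linarith [le_of_max_le_right ht])) hu).trans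
      (hdec t (le_of_max_le_left ht))⟩

end IsLogFlow

end EnergyEstimates

section Flow

/-- The partial derivative in the first variable of a map smooth up to the initial time. -/
lemma contDiffOn_deriv_fst {V : Type*} [NormedAddCommGroup V] [NormedSpace ℝ V] {f : ℝ → ℝ → V}
    (hf : ContDiffOn ℝ ∞ (fun p : ℝ × ℝ => f p.1 p.2) (Set.univ ×ˢ Set.Ici (0 : ℝ))) :
    ContDiffOn ℝ ∞ (fun p : ℝ × ℝ => deriv (fun v => f v p.2) p.1)
      (Set.univ ×ˢ Set.Ici (0 : ℝ)) := by
  have hu : UniqueDiffOn ℝ (Set.univ ×ˢ Set.Ici (0 : ℝ) : Set (ℝ × ℝ)) :=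
    uniqueDiffOn_univ.prod (uniqueDiffOn_Ici 0)
  refine ((hf.fderivWithin hu (m := ∞) (by simp)).clm_apply
    (contDiffOn_const (c := ((1, 0) : ℝ × ℝ)))).congr fun p hp => ?_
  have hd := (hf.differentiableOn (by simp) p hp).hasFDerivWithinAt
  have hline : HasDerivAt (fun v : ℝ => (v, p.2)) ((1, 0) : ℝ × ℝ) p.1 :=
    (hasDerivAt_id p.1).prodMk (hasDerivAt_const p.1 p.2)
  exact (hd.comp_hasDerivAt (l := fun p : ℝ × ℝ => f p.1 p.2) p.1 hline
    (Filter.Eventually.of_forall fun _ => Set.mk_mem_prod (Set.mem_univ _) hp.2)).deriv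

namespace SphereCSF

lemma curvSq_continuousOn (F : SphereCSF (Set.Ici 0)) :
    ContinuousOn (fun p : ℝ × ℝ => F.curvSq p.1 p.2) (Set.univ ×ˢ Set.Ici (0 : ℝ)) := by
  have h1 := contDiffOn_deriv_fst F.smooth
  have hv := (h1.norm ℝ fun p hp => F.regular p.2 hp.2 p.1).inv
    fun p hp => norm_ne_zero_iff.2 (F.regular p.2 hp.2 p.1)
  have hT : ContDiffOn ℝ ∞ (fun p : ℝ × ℝ => pS F.γ F.γ p.1 p.2) (Set.univ ×ˢ Set.Ici (0 : ℝ)) :=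
    hv.smul h1
  have hc : ContDiffOn ℝ ∞ (fun p : ℝ × ℝ => curvVec F.γ p.1 p.2)
      (Set.univ ×ˢ Set.Ici (0 : ℝ)) :=
    (hv.smul (contDiffOn_deriv_fst hT)).add F.smooth
  exact hc.continuousOn.norm.pow 2

lemma pS_periodic {γ f : ℝ → ℝ → EuclideanSpace ℝ (Fin 3)} {t c : ℝ}
    (hγ : Function.Periodic (fun u => γ u t) c) (hf : Function.Periodic (fun u => f u t) c) :
    Function.Periodic (fun u => pS γ f u t) c := fun u => by
  have key : ∀ {k : ℝ → EuclideanSpace ℝ (Fin 3)}, Function.Periodic k c →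
      deriv k (u + c) = deriv k u := fun {k} hk => by
    rw [← deriv_comp_add_const, funext hk]
  simp only [pS, key hγ, key hf]

lemma curvSq_periodic (F : SphereCSF (Set.Ici 0)) {t : ℝ} (ht : 0 ≤ t) :
    Function.Periodic (fun u => F.curvSq u t) (2 * π) := fun u => by
  have h1 := F.periodic t ht
  have h2 := pS_periodic h1 (pS_periodic h1 h1) u
  have h3 := h1 u
  simp only at h2 h3
  simp only [curvSq, curvVec, h2, h3]

/-- The flow in logarithmic time. -/
def logFlow (F : SphereCSF (Set.Ici 0)) (p : ℝ × ℝ) : EuclideanSpace ℝ (Fin 3) :=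
  F.γ p.1 (Real.exp p.2)

variable (F : SphereCSF (Set.Ici 0))

lemma logFlow_smooth : ContDiff ℝ ∞ F.logFlow := by
  have h : ContDiff ℝ ∞ fun p : ℝ × ℝ => (p.1, Real.exp p.2) :=
    contDiff_fst.prodMk contDiff_snd.exp
  exact F.smooth.comp_contDiff h fun p => ⟨trivial, (Real.exp_pos _).le⟩

lemma dirDeriv_fst_logFlow (p : ℝ × ℝ) :
    dirDeriv (1, 0) F.logFlow p = deriv (fun v => F.γ v (Real.exp p.2)) p.1 :=
  (hasDerivAt_fst F.logFlow_smooth p.1 p.2).deriv.symm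

lemma gSpeed_logFlow (p : ℝ × ℝ) : gSpeed F.logFlow p = F.speed p.1 (Real.exp p.2) := by
  rw [gSpeed, dirDeriv_fst_logFlow, speed]

lemma gTangent_logFlow (p : ℝ × ℝ) :
    gTangent F.logFlow p = pS F.γ F.γ p.1 (Real.exp p.2) := by
  rw [gTangent, gArc, gSpeed, dirDeriv_fst_logFlow, pS]

lemma gTangent_logFlow_smooth : ContDiff ℝ ∞ (gTangent F.logFlow) := by
  have h := contDiff_dirDeriv F.logFlow_smooth (1, 0)
  have h0 : ∀ p, dirDeriv (1, 0) F.logFlow p ≠ 0 := fun p => by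
    rw [dirDeriv_fst_logFlow]
    exact F.regular _ (Real.exp_pos _).le _
  exact ((h.norm ℝ h0).inv fun p => norm_ne_zero_iff.2 (h0 p)).smul h

lemma gArc_gTangent_logFlow (p : ℝ × ℝ) :
    gArc F.logFlow (gTangent F.logFlow) p + F.logFlow p = curvVec F.γ p.1 (Real.exp p.2) := by
  have h := (hasDerivAt_fst F.gTangent_logFlow_smooth p.1 p.2).deriv
  simp only [gTangent_logFlow] at h
  rw [gArc, gSpeed_logFlow, ← h]
  rfl

lemma isLogFlow : IsLogFlow F.logFlow where
  smooth := F.logFlow_smooth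
  unit p := F.spherical _ (Real.exp_pos _).le _
  regular p := by
    rw [dirDeriv_fst_logFlow]
    exact F.regular _ (Real.exp_pos _).le _
  periodic u τ := F.periodic _ (Real.exp_pos _).le u
  flow p := by
    have h1 := hasDerivAt_snd F.logFlow_smooth p.1 p.2
    have h2 := (F.flow _ (Real.exp_pos p.2).le p.1).hasDerivAt (Ici_mem_nhds (Real.exp_pos p.2))
    rw [gArc_gTangent_logFlow]
    exact h1.unique (h2.scomp p.2 (Real.hasDerivAt_exp p.2))

lemma curvSq_eq (u : ℝ) {t : ℝ} (ht : 0 < t) :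
    F.curvSq u t = gCurv F.logFlow (u, Real.log t) ^ 2 := by
  have h := F.isLogFlow
  have h1 := F.gArc_gTangent_logFlow (u, Real.log t)
  rw [h.arc_tangent, Real.exp_log ht, neg_add_cancel_comm] at h1
  rw [curvSq, ← h1, ← real_inner_self_eq_norm_sq, inner_smul_left, inner_smul_right,
    h.normal_normal]
  simp
  ring

lemma length_eq {t : ℝ} (ht : 0 < t) : F.length t = gLength F.logFlow (Real.log t) := by
  simp only [length, gLength, gSpeed_logFlow, Real.exp_log ht]

lemma length_tendsto_and_curvSq_decay :
    Filter.Tendsto F.length Filter.atTop (nhds (2 * π)) ∧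
    ∃ C > (0 : ℝ), ∃ δ > (0 : ℝ), ∀ t : ℝ, 0 ≤ t → ∀ u : ℝ,
      F.curvSq u t ≤ C * Real.exp (-δ * t) := by
  obtain ⟨hlim, T, hT, C, hC, δ, hδ, hdec⟩ := F.isLogFlow.length_tendsto_and_curv_decay
    fun τ => F.simple _ (Real.exp_pos τ).le
  refine ⟨hlim.congr' ?_, ?_⟩
  · filter_upwards [Filter.eventually_gt_atTop 0] with t ht
    exact (F.length_eq ht).symm
  obtain ⟨M, hM⟩ := (isCompact_Icc.prod isCompact_Icc).bddAbove_image
    (F.curvSq_continuousOn.mono (Set.prod_mono (Set.subset_univ (Set.Icc 0 (2 * π)))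
      (Set.Icc_subset_Ici_self : Set.Icc 0 T ⊆ _)))
  have hpi : (0 : ℝ) < 2 * π := by positivity
  refine ⟨C + |M| * Real.exp (δ * T), by positivity, δ, hδ, fun t ht u => ?_⟩
  obtain ⟨w, hw, hw'⟩ := (F.curvSq_periodic ht).exists_mem_Ico₀ hpi u
  have hw := Set.Ico_subset_Icc_self hw
  change F.curvSq u t = F.curvSq w t at hw'
  rw [hw', add_mul, mul_assoc, ← Real.exp_add]
  rcases le_total T t with hTt | hTt
  · rw [F.curvSq_eq w (hT.trans_le hTt)]
    linarith [hdec t hTt w hw, show 0 ≤ |M| * Real.exp (δ * T + -δ * t) by positivity]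
  · have h1 : F.curvSq w t ≤ M := hM ⟨(w, t), ⟨hw, ht, hTt⟩, rfl⟩
    have h2 : 1 ≤ Real.exp (δ * T + -δ * t) := Real.one_le_exp (by nlinarith)
    have h3 : |M| * 1 ≤ |M| * Real.exp (δ * T + -δ * t) := by gcongr
    linarith [le_abs_self M, show 0 ≤ C * Real.exp (-δ * t) by positivity]

end SphereCSF

end Flow

/-- Infinite-time case of the spherical Grayson theorem: for a curve shortening flow of
simple closed spherical curves defined for all `t ≥ 0` and satisfying the initial
chord-arc hypothesis, the length converges to `2π` and the (squared) geodesic curvature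
decays exponentially. -/
theorem infinite_time_convergence (F : SphereCSF (Set.Ici 0)) (a : ℝ) (ha : 0 < a)
    (h0 : ∀ u ∈ Set.Ico (0 : ℝ) (2 * π), ∀ v ∈ Set.Ico (0 : ℝ) (2 * π),
      F.chord 0 u v / F.length 0
        ≥ a⁻¹ * Real.arctan (a / π * Real.sin (π * F.arcLen 0 u v / F.length 0))) :
    Filter.Tendsto F.length Filter.atTop (nhds (2 * π)) ∧
    ∃ C > (0 : ℝ), ∃ δ > (0 : ℝ), ∀ t : ℝ, 0 ≤ t → ∀ u : ℝ,
      F.curvSq u t ≤ C * Real.exp (-δ * t) := by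
  exact F.length_tendsto_and_curvSq_decay

end
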